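/- arXiv:2111.00458 — 13 statements merged into one kernel-verified Lean document; each statement's English description precedes it below -/
import Mathlib

section
/- Let ξ = (x, y, z) : I → ℝ³ be a unit-speed spherical curve on an open interval I. Then its spherical angular momentum 𝒦 is differentiable and 𝒦'(s) = κ(s)·z'(s) for every s ∈ I; that is, along the curve the angular momentum is an antiderivative of the geodesic curvature with respect to the height z. -/
open Real Set

/-- Geodesic curvature of a unit-speed spherical curve with components `x, y, z`:
`κ(s) = det(ξ(s), ξ'(s), ξ''(s))`. -/
noncomputable def sphCurv (x y z : ℝ → ℝ) (s : ℝ) : ℝ :=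
  Matrix.det !![x s, y s, z s;
                deriv x s, deriv y s, deriv z s;
                deriv (deriv x) s, deriv (deriv y) s, deriv (deriv z) s]

/-- Spherical angular momentum `𝒦(s) = x'(s)·y(s) − x(s)·y'(s)`. -/
noncomputable def sphMom (x y : ℝ → ℝ) (s : ℝ) : ℝ :=
  deriv x s * y s - x s * deriv y s

/-- The spherical angular momentum is differentiable and `𝒦'(s) = κ(s)·z'(s)`. -/
theorem sphMom_deriv (t₀ t₁ : ℝ) (x y z : ℝ → ℝ)
    (hx : ContDiffOn ℝ 2 x (Ioo t₀ t₁)) (hy : ContDiffOn ℝ 2 y (Ioo t₀ t₁))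
    (hz : ContDiffOn ℝ 2 z (Ioo t₀ t₁))
    (hsph : ∀ s ∈ Ioo t₀ t₁, x s ^ 2 + y s ^ 2 + z s ^ 2 = 1)
    (hunit : ∀ s ∈ Ioo t₀ t₁, deriv x s ^ 2 + deriv y s ^ 2 + deriv z s ^ 2 = 1) :
    ∀ s ∈ Ioo t₀ t₁,
      DifferentiableAt ℝ (sphMom x y) s ∧
      deriv (sphMom x y) s = sphCurv x y z s * deriv z s := by
  intro s hs
  have hn : Ioo t₀ t₁ ∈ nhds s := isOpen_Ioo.mem_nhds hs
  have d1 : ∀ f : ℝ → ℝ, ContDiffOn ℝ 2 f (Ioo t₀ t₁) → HasDerivAt f (deriv f s) s := by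
    intro f hf
    exact ((hf.contDiffAt hn).differentiableAt (by norm_num)).hasDerivAt
  have d2 : ∀ f : ℝ → ℝ, ContDiffOn ℝ 2 f (Ioo t₀ t₁) →
      HasDerivAt (deriv f) (deriv (deriv f) s) s := by
    intro f hf
    have h : ContDiffOn ℝ 1 (deriv f) (Ioo t₀ t₁) :=
      hf.deriv_of_isOpen isOpen_Ioo (by norm_num)
    exact ((h.contDiffAt hn).differentiableAt (by norm_num)).hasDerivAt
  have const : ∀ (a b c : ℝ → ℝ) (a' b' c' : ℝ), HasDerivAt a a' s → HasDerivAt b b' s →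
      HasDerivAt c c' s → (∀ t ∈ Ioo t₀ t₁, a t ^ 2 + b t ^ 2 + c t ^ 2 = 1) →
      a s * a' + b s * b' + c s * c' = 0 := by
    intro a b c a' b' c' ha hb hc h
    have h1 := ((ha.pow 2).add (hb.pow 2)).add (hc.pow 2)
    have h2 : HasDerivAt (a ^ 2 + b ^ 2 + c ^ 2) 0 s := by
      refine (hasDerivAt_const s (1 : ℝ)).congr_of_eventuallyEq ?_
      filter_upwards [hn] with t ht
      simpa using h t ht
    have h3 := h1.unique h2
    norm_num at h3
    linarith
  have hB := const _ _ _ _ _ _ (d1 x hx) (d1 y hy) (d1 z hz) hsph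
  have hA := const _ _ _ _ _ _ (d2 x hx) (d2 y hy) (d2 z hz) hunit
  have hP := hunit s hs
  have hK : HasDerivAt (sphMom x y) _ s :=
    ((d2 x hx).mul (d1 y hy)).sub ((d1 x hx).mul (d2 y hy))
  refine ⟨hK.differentiableAt, ?_⟩
  rw [hK.deriv, sphCurv, Matrix.det_fin_three]
  simp only [Matrix.of_apply, Matrix.cons_val', Matrix.cons_val_zero, Matrix.cons_val_one,
    Matrix.cons_val]
  linear_combination (-(deriv (deriv x) s * y s - deriv (deriv y) s * x s)) * hP
    + (deriv x s * y s - deriv y s * x s) * hA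
    - (deriv x s * deriv (deriv y) s - deriv y s * deriv (deriv x) s) * hB
end

section
/- Let F : ℝ → ℝ be continuously differentiable, and let z, λ : I → ℝ be differentiable on an open interval I with |z(s)| < 1, 1 − z(s)² − F(z(s))² > 0, z'(s) = √(1 − z(s)² − F(z(s))²), and λ'(s) = F(z(s))/(z(s)² − 1) for all s ∈ I. Then ξ(s) := (√(1 − z(s)²)·cos λ(s), √(1 − z(s)²)·sin λ(s), z(s)) is a unit-speed spherical curve whose spherical angular momentum satisfies 𝒦(s) = F(z(s)) and whose geodesic curvature satisfies κ(s) = F'(z(s)) for every s ∈ I. (Existence part of the quadrature theorem: a spherical curve whose curvature κ is a prescribed continuous function of the signed distance z to the great circle z = 0 is obtained by quadratures from an antiderivative F of κ.) -/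
lemma aux_two {f : ℝ → ℝ} {s : Set ℝ} (hs : IsOpen s) (hd : DifferentiableOn ℝ f s)
    (h : ContDiffOn ℝ 1 (deriv f) s) : ContDiffOn ℝ 2 f s := by
  have := (contDiffOn_succ_iff_deriv_of_isOpen (n := 1) (f := f) hs).2 ⟨hd, by simp, h⟩
  simpa [one_add_one_eq_two] using this

lemma aux_one {f : ℝ → ℝ} {s : Set ℝ} (hs : IsOpen s) (hd : DifferentiableOn ℝ f s)
    (h : ContDiffOn ℝ 0 (deriv f) s) : ContDiffOn ℝ 1 f s := by
  have := (contDiffOn_succ_iff_deriv_of_isOpen (n := 0) (f := f) hs).2 ⟨hd, by simp, h⟩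
  simpa using this

lemma aux_d2 {f : ℝ → ℝ} {s : Set ℝ} (hs : IsOpen s) (h : ContDiffOn ℝ 2 f s) {a : ℝ}
    (ha : a ∈ s) : HasDerivAt (deriv f) (deriv (deriv f) a) a := by
  have h' : ContDiffOn ℝ (1 + 1) f s := by simpa [one_add_one_eq_two] using h
  have := ((contDiffOn_succ_iff_deriv_of_isOpen (n := 1) (f := f) hs).1 h').2.2
  exact ((this.differentiableOn (by simp)).differentiableAt (hs.mem_nhds ha)).hasDerivAt

lemma aux_alg (x y z x1 y1 z1 x2 y2 z2 k : ℝ) (hz1 : z1 ≠ 0)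
    (h0 : x * x1 + y * y1 + z * z1 = 0) (h1 : x1 ^ 2 + y1 ^ 2 + z1 ^ 2 = 1)
    (h2 : x1 * x2 + y1 * y2 + z1 * z2 = 0) (h3 : x * y2 - y * x2 = - (k * z1)) :
    x * y1 * z2 - x * z1 * y2 - y * x1 * z2 + y * z1 * x2 + z * x1 * y2 - z * y1 * x2 = k := by
  apply mul_right_cancel₀ hz1
  linear_combination (x1 * y2 - y1 * x2) * h0 - (x * y2 - y * x2) * h1
    + (x * y1 - y * x1) * h2 - h3


open Real Set

/-- Existence part of the quadrature theorem: from an antiderivative `F` of a prescribed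
curvature function and solutions `z, λ` of the quadrature ODEs one obtains a unit-speed
spherical curve with `𝒦 = F(z)` and `κ = F'(z)`. -/
theorem quadrature_existence (F : ℝ → ℝ) (hF : ContDiff ℝ 1 F)
    (t₀ t₁ : ℝ) (z lam : ℝ → ℝ)
    (hzdiff : ∀ s ∈ Ioo t₀ t₁, DifferentiableAt ℝ z s)
    (hlamdiff : ∀ s ∈ Ioo t₀ t₁, DifferentiableAt ℝ lam s)
    (hzlt : ∀ s ∈ Ioo t₀ t₁, |z s| < 1)
    (hpos : ∀ s ∈ Ioo t₀ t₁, 1 - z s ^ 2 - F (z s) ^ 2 > 0)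
    (hz' : ∀ s ∈ Ioo t₀ t₁, deriv z s = Real.sqrt (1 - z s ^ 2 - F (z s) ^ 2))
    (hlam' : ∀ s ∈ Ioo t₀ t₁, deriv lam s = F (z s) / (z s ^ 2 - 1)) :
    let x : ℝ → ℝ := fun s => Real.sqrt (1 - z s ^ 2) * cos (lam s)
    let y : ℝ → ℝ := fun s => Real.sqrt (1 - z s ^ 2) * sin (lam s)
    ContDiffOn ℝ 2 x (Ioo t₀ t₁) ∧ ContDiffOn ℝ 2 y (Ioo t₀ t₁) ∧
    ContDiffOn ℝ 2 z (Ioo t₀ t₁) ∧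
    (∀ s ∈ Ioo t₀ t₁, x s ^ 2 + y s ^ 2 + z s ^ 2 = 1) ∧
    (∀ s ∈ Ioo t₀ t₁, deriv x s ^ 2 + deriv y s ^ 2 + deriv z s ^ 2 = 1) ∧
    (∀ s ∈ Ioo t₀ t₁, sphMom x y s = F (z s)) ∧
    (∀ s ∈ Ioo t₀ t₁, sphCurv x y z s = deriv F (z s)) := by
  intro x y
  have ho : IsOpen (Ioo t₀ t₁) := isOpen_Ioo
  have hzd : DifferentiableOn ℝ z (Ioo t₀ t₁) := fun s hs => (hzdiff s hs).differentiableWithinAt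
  have hld : DifferentiableOn ℝ lam (Ioo t₀ t₁) :=
    fun s hs => (hlamdiff s hs).differentiableWithinAt
  have hr : ∀ s ∈ Ioo t₀ t₁, 0 < 1 - z s ^ 2 := fun s hs => by
    nlinarith [hpos s hs, sq_nonneg (F (z s))]
  have key : ∀ n : WithTop ℕ∞, n ≤ 1 → ContDiffOn ℝ n z (Ioo t₀ t₁) →
      ContDiffOn ℝ n (deriv z) (Ioo t₀ t₁) := by
    intro n hn h
    refine ContDiffOn.congr ?_ hz'
    have hFz : ContDiffOn ℝ n (fun s => F (z s)) (Ioo t₀ t₁) := (hF.of_le hn).comp_contDiffOn h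
    exact ContDiffOn.sqrt ((contDiffOn_const.sub (h.pow 2)).sub (hFz.pow 2))
      (fun s hs => (hpos s hs).ne')
  have hz0 : ContDiffOn ℝ 0 z (Ioo t₀ t₁) := contDiffOn_zero.2 hzd.continuousOn
  have hz1 : ContDiffOn ℝ 1 z (Ioo t₀ t₁) := aux_one ho hzd (key 0 (by simp) hz0)
  have hz2 : ContDiffOn ℝ 2 z (Ioo t₀ t₁) := aux_two ho hzd (key 1 le_rfl hz1)
  have hl2 : ContDiffOn ℝ 2 lam (Ioo t₀ t₁) := by
    refine aux_two ho hld (ContDiffOn.congr ?_ hlam')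
    exact ContDiffOn.div (hF.comp_contDiffOn hz1) ((hz1.pow 2).sub contDiffOn_const)
      (fun s hs => by have := hr s hs; intro h; linarith)
  have hrr : ContDiffOn ℝ 2 (fun s => Real.sqrt (1 - z s ^ 2)) (Ioo t₀ t₁) :=
    ContDiffOn.sqrt (contDiffOn_const.sub (hz2.pow 2)) (fun s hs => (hr s hs).ne')
  have hx2 : ContDiffOn ℝ 2 x (Ioo t₀ t₁) :=
    hrr.mul (Real.contDiff_cos.comp_contDiffOn hl2)
  have hy2 : ContDiffOn ℝ 2 y (Ioo t₀ t₁) :=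
    hrr.mul (Real.contDiff_sin.comp_contDiffOn hl2)
  have d1 : ∀ f : ℝ → ℝ, ContDiffOn ℝ 2 f (Ioo t₀ t₁) → ∀ s ∈ Ioo t₀ t₁,
      HasDerivAt f (deriv f s) s := fun f hf s hs =>
    ((hf.differentiableOn (by simp)).differentiableAt (ho.mem_nhds hs)).hasDerivAt
  have hsph : ∀ s ∈ Ioo t₀ t₁, x s ^ 2 + y s ^ 2 + z s ^ 2 = 1 := by
    intro s hs
    have h1 := Real.sq_sqrt (hr s hs).le
    have h2 := Real.sin_sq_add_cos_sq (lam s)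
    simp only [x, y]
    linear_combination (1 - z s ^ 2) * h2 + (sin (lam s) ^ 2 + cos (lam s) ^ 2) * h1
  have hrd : ∀ s ∈ Ioo t₀ t₁, Real.sqrt (1 - z s ^ 2) *
      deriv (fun s => Real.sqrt (1 - z s ^ 2)) s = - (z s * deriv z s) := by
    intro s hs
    have a := ((d1 z hz2 s hs).pow 2).const_sub 1
    have b := (a.sqrt (hr s hs).ne').deriv
    have hp := Real.sqrt_pos.2 (hr s hs)
    have b' : deriv (fun s => Real.sqrt (1 - z s ^ 2)) s = _ := b
    rw [b']
    simp only [Pi.pow_apply]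
    field_simp
    try norm_num
    try ring
  have hxd : ∀ s ∈ Ioo t₀ t₁, deriv x s = deriv (fun s => Real.sqrt (1 - z s ^ 2)) s * cos (lam s)
      + Real.sqrt (1 - z s ^ 2) * (- sin (lam s) * deriv lam s) := fun s hs =>
    ((d1 _ hrr s hs).mul (d1 _ hl2 s hs).cos).deriv
  have hyd : ∀ s ∈ Ioo t₀ t₁, deriv y s = deriv (fun s => Real.sqrt (1 - z s ^ 2)) s * sin (lam s)
      + Real.sqrt (1 - z s ^ 2) * (cos (lam s) * deriv lam s) := fun s hs =>
    ((d1 _ hrr s hs).mul (d1 _ hl2 s hs).sin).deriv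
  have hl : ∀ s ∈ Ioo t₀ t₁, (1 - z s ^ 2) * deriv lam s = - F (z s) := by
    intro s hs
    have h := hr s hs
    have h' : z s ^ 2 - 1 ≠ 0 := by intro h; linarith
    rw [hlam' s hs]
    field_simp
    ring
  have hmom : ∀ s ∈ Ioo t₀ t₁, deriv x s * y s - x s * deriv y s = F (z s) := by
    intro s hs
    have h1 := Real.sq_sqrt (hr s hs).le
    have h2 := Real.sin_sq_add_cos_sq (lam s)
    rw [hxd s hs, hyd s hs]
    simp only [x, y]
    linear_combination (-Real.sqrt (1 - z s ^ 2) ^ 2 * deriv lam s) * h2 - deriv lam s * h1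
      - hl s hs
  have hspeed : ∀ s ∈ Ioo t₀ t₁, deriv x s ^ 2 + deriv y s ^ 2 + deriv z s ^ 2 = 1 := by
    intro s hs
    have h1 := Real.sq_sqrt (hr s hs).le
    have h2 := Real.sin_sq_add_cos_sq (lam s)
    have h3 : deriv z s ^ 2 = 1 - z s ^ 2 - F (z s) ^ 2 := by rw [hz' s hs, Real.sq_sqrt (hpos s hs).le]
    have h4 := hl s hs
    have h5 := hrd s hs
    have hp := hr s hs
    rw [hxd s hs, hyd s hs]
    generalize deriv (fun s => Real.sqrt (1 - z s ^ 2)) s = r' at *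
    generalize Real.sqrt (1 - z s ^ 2) = r at *
    generalize deriv lam s = l' at *
    generalize deriv z s = w at *
    generalize sin (lam s) = S at *
    generalize cos (lam s) = C at *
    have e : (r' * C + r * (-S * l')) ^ 2 + (r' * S + r * (C * l')) ^ 2 + w ^ 2
        = r' ^ 2 + r ^ 2 * l' ^ 2 + w ^ 2 := by
      linear_combination (r' ^ 2 + r ^ 2 * l' ^ 2) * h2
    rw [e]
    apply mul_left_cancel₀ hp.ne'
    linear_combination (-r' ^ 2 + (1 - z s ^ 2) * l' ^ 2) * h1 + (r * r' - z s * w) * h5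
      + ((1 - z s ^ 2) * l' - F (z s)) * h4 + h3
  refine ⟨hx2, hy2, hz2, hsph, hspeed, hmom, ?_⟩
  intro s hs
  have hnh := ho.mem_nhds hs
  have X1 := d1 x hx2 s hs
  have Y1 := d1 y hy2 s hs
  have Z1 := d1 z hz2 s hs
  have X2 := aux_d2 ho hx2 hs
  have Y2 := aux_d2 ho hy2 hs
  have Z2 := aux_d2 ho hz2 hs
  have e0 := HasDerivAt.unique (((X1.pow 2).add (Y1.pow 2)).add (Z1.pow 2))
    ((hasDerivAt_const s (1 : ℝ)).congr_of_eventuallyEq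
      (Filter.eventually_of_mem hnh fun t ht => hsph t ht))
  have e1 := HasDerivAt.unique (((X2.pow 2).add (Y2.pow 2)).add (Z2.pow 2))
    ((hasDerivAt_const s (1 : ℝ)).congr_of_eventuallyEq
      (Filter.eventually_of_mem hnh fun t ht => hspeed t ht))
  have hFd : HasDerivAt F (deriv F (z s)) (z s) :=
    (hF.differentiable (by simp) (z s)).hasDerivAt
  have e2 := HasDerivAt.unique ((X2.mul Y1).sub (X1.mul Y2))
    ((hFd.comp s Z1).congr_of_eventuallyEq
      (Filter.eventually_of_mem hnh fun t ht => hmom t ht))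
  have hzne : deriv z s ≠ 0 := by
    rw [hz' s hs]; exact (Real.sqrt_pos.2 (hpos s hs)).ne'
  norm_num at e0 e1
  have := aux_alg (x s) (y s) (z s) (deriv x s) (deriv y s) (deriv z s) (deriv (deriv x) s)
    (deriv (deriv y) s) (deriv (deriv z) s) (deriv F (z s)) hzne (by linarith) (hspeed s hs)
    (by linarith) (by linarith)
  rw [sphCurv, Matrix.det_fin_three]
  simp
  linarith
end

section
/- Let F : ℝ → ℝ be continuously differentiable and let ξ₁ = (x₁, y₁, z₁) and ξ₂ = (x₂, y₂, z₂) be unit-speed spherical curves on an open interval I containing 0, with spherical angular momenta 𝒦₁, 𝒦₂. Suppose that for i = 1, 2 and all s ∈ I: |z_i(s)| < 1, z_i'(s) > 0, and 𝒦_i(s) = F(z_i(s)), and suppose z₁(0) = z₂(0). Then ξ₂ is obtained from ξ₁ by a rotation around the z-axis: there exists θ ∈ ℝ such that for all s ∈ I, ξ₂(s) = (cos θ·x₁(s) − sin θ·y₁(s), sin θ·x₁(s) + cos θ·y₁(s), z₁(s)). (Uniqueness part of the quadrature theorem: a spherical curve with nonconstant z is uniquely determined, up to rotation around the z-axis, by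 its spherical angular momentum as a function of z.) -/
open Real Set

open Topology in
lemma height_unique {G : ℝ → ℝ} (hG : ContDiff ℝ 1 G) {t₀ t₁ : ℝ} (h0 : (0 : ℝ) ∈ Ioo t₀ t₁)
    {z₁ z₂ : ℝ → ℝ}
    (hd₁ : ∀ s ∈ Ioo t₀ t₁, DifferentiableAt ℝ z₁ s)
    (hd₂ : ∀ s ∈ Ioo t₀ t₁, DifferentiableAt ℝ z₂ s)
    (hp₁ : ∀ s ∈ Ioo t₀ t₁, deriv z₁ s > 0) (hp₂ : ∀ s ∈ Ioo t₀ t₁, deriv z₂ s > 0)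
    (he₁ : ∀ s ∈ Ioo t₀ t₁, deriv z₁ s ^ 2 = G (z₁ s))
    (he₂ : ∀ s ∈ Ioo t₀ t₁, deriv z₂ s ^ 2 = G (z₂ s))
    (hz0 : z₁ 0 = z₂ 0) : ∀ s ∈ Ioo t₀ t₁, z₂ s = z₁ s := by
  have key : ∀ z : ℝ → ℝ, (∀ s ∈ Ioo t₀ t₁, DifferentiableAt ℝ z s) →
      (∀ s ∈ Ioo t₀ t₁, deriv z s > 0) → (∀ s ∈ Ioo t₀ t₁, deriv z s ^ 2 = G (z s)) →
      ∀ s ∈ Ioo t₀ t₁, HasDerivAt z (√(G (z s))) s := by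
    intro z hd hp he s hs
    rw [← he s hs, Real.sqrt_sq (hp s hs).le]
    exact (hd s hs).hasDerivAt
  have loc : ∀ s ∈ Ioo t₀ t₁, z₁ s = z₂ s → z₁ =ᶠ[𝓝 s] z₂ := by
    intro s hs heq
    have hpos : G (z₁ s) ≠ 0 := by
      rw [← he₁ s hs]; exact (pow_pos (hp₁ s hs) 2).ne'
    have hc : ContDiffAt ℝ 1 (fun u => √(G u)) (z₁ s) := hG.contDiffAt.sqrt hpos
    obtain ⟨K, t, ht, hL⟩ := hc.exists_lipschitzOnWith
    have hI : ∀ᶠ r in 𝓝 s, r ∈ Ioo t₀ t₁ := isOpen_Ioo.mem_nhds hs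
    refine ODE_solution_unique_of_eventually (v := fun _ u => √(G u)) (s := fun _ => t) (K := K)
      (Filter.Eventually.of_forall fun _ => hL) ?_ ?_ heq
    · filter_upwards [hI, (hd₁ s hs).continuousAt ht] with r hr hr2
      exact ⟨key z₁ hd₁ hp₁ he₁ r hr, hr2⟩
    · filter_upwards [hI, (hd₂ s hs).continuousAt (heq ▸ ht)] with r hr hr2
      exact ⟨key z₂ hd₂ hp₂ he₂ r hr, hr2⟩
  have hsub : Ioo t₀ t₁ ⊆ {s | z₁ =ᶠ[𝓝 s] z₂} := by
    refine isPreconnected_Ioo.subset_of_closure_inter_subset ?_ ⟨0, h0, loc 0 h0 hz0⟩ ?_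
    · exact isOpen_iff_mem_nhds.2 fun s hs => eventually_eventually_nhds.2 hs
    · rintro s ⟨hs, hsI⟩
      refine loc s hsI ?_
      by_contra hne
      have h1 := ((hd₁ s hsI).continuousAt.sub (hd₂ s hsI).continuousAt).eventually_ne
        (sub_ne_zero.2 hne)
      obtain ⟨r, hr, hr2⟩ := ((mem_closure_iff_frequently.1 hs).and_eventually h1).exists
      exact hr2 (sub_eq_zero.2 (Filter.EventuallyEq.eq_of_nhds hr))
  intro s hs
  exact (Filter.EventuallyEq.eq_of_nhds (hsub hs)).symm

lemma radial {x y z : ℝ → ℝ} {t₀ t₁ : ℝ}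
    (hx : ∀ s ∈ Ioo t₀ t₁, DifferentiableAt ℝ x s)
    (hy : ∀ s ∈ Ioo t₀ t₁, DifferentiableAt ℝ y s)
    (hz : ∀ s ∈ Ioo t₀ t₁, DifferentiableAt ℝ z s)
    (h : ∀ s ∈ Ioo t₀ t₁, x s ^ 2 + y s ^ 2 + z s ^ 2 = 1) :
    ∀ s ∈ Ioo t₀ t₁, x s * deriv x s + y s * deriv y s = - (z s * deriv z s) := by
  intro s hs
  have h1 := (((hx s hs).hasDerivAt.pow 2).add ((hy s hs).hasDerivAt.pow 2)).add
    ((hz s hs).hasDerivAt.pow 2)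
  have h2 : HasDerivAt (x ^ 2 + y ^ 2 + z ^ 2) 0 s := by
    refine (hasDerivAt_const s (1 : ℝ)).congr_of_eventuallyEq ?_
    filter_upwards [isOpen_Ioo.mem_nhds hs] with r hr
    simpa using h r hr
  have h3 := h1.unique h2
  norm_num at h3
  linarith

/-- The height satisfies an autonomous first-order equation. -/
lemma height_eq {x y z a b c k : ℝ} (h1 : x ^ 2 + y ^ 2 + z ^ 2 = 1)
    (h2 : a ^ 2 + b ^ 2 + c ^ 2 = 1) (h3 : x * a + y * b = - (z * c))
    (h4 : a * y - x * b = k) : c ^ 2 = 1 - z ^ 2 - k ^ 2 := by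
  have e1 : (x ^ 2 + y ^ 2) * (a ^ 2 + b ^ 2) = (x * a + y * b) ^ 2 + (a * y - x * b) ^ 2 := by ring
  rw [h3, h4, show x ^ 2 + y ^ 2 = 1 - z ^ 2 by linarith,
    show a ^ 2 + b ^ 2 = 1 - c ^ 2 by linarith] at e1
  linarith

/-- Uniqueness part of the quadrature theorem: two unit-speed spherical curves with strictly
increasing height `z`, the same angular momentum profile `𝒦 = F(z)` and the same initial
height differ by a rotation around the `z`-axis. -/
theorem quadrature_uniqueness (F : ℝ → ℝ) (hF : ContDiff ℝ 1 F)
    (t₀ t₁ : ℝ) (h0 : (0 : ℝ) ∈ Ioo t₀ t₁)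
    (x₁ y₁ z₁ x₂ y₂ z₂ : ℝ → ℝ)
    (hx₁ : ContDiffOn ℝ 2 x₁ (Ioo t₀ t₁)) (hy₁ : ContDiffOn ℝ 2 y₁ (Ioo t₀ t₁))
    (hz₁ : ContDiffOn ℝ 2 z₁ (Ioo t₀ t₁))
    (hx₂ : ContDiffOn ℝ 2 x₂ (Ioo t₀ t₁)) (hy₂ : ContDiffOn ℝ 2 y₂ (Ioo t₀ t₁))
    (hz₂ : ContDiffOn ℝ 2 z₂ (Ioo t₀ t₁))
    (hsph₁ : ∀ s ∈ Ioo t₀ t₁, x₁ s ^ 2 + y₁ s ^ 2 + z₁ s ^ 2 = 1)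
    (hsph₂ : ∀ s ∈ Ioo t₀ t₁, x₂ s ^ 2 + y₂ s ^ 2 + z₂ s ^ 2 = 1)
    (hunit₁ : ∀ s ∈ Ioo t₀ t₁, deriv x₁ s ^ 2 + deriv y₁ s ^ 2 + deriv z₁ s ^ 2 = 1)
    (hunit₂ : ∀ s ∈ Ioo t₀ t₁, deriv x₂ s ^ 2 + deriv y₂ s ^ 2 + deriv z₂ s ^ 2 = 1)
    (hzlt₁ : ∀ s ∈ Ioo t₀ t₁, |z₁ s| < 1) (hzlt₂ : ∀ s ∈ Ioo t₀ t₁, |z₂ s| < 1)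
    (hz₁' : ∀ s ∈ Ioo t₀ t₁, deriv z₁ s > 0) (hz₂' : ∀ s ∈ Ioo t₀ t₁, deriv z₂ s > 0)
    (hK₁ : ∀ s ∈ Ioo t₀ t₁, sphMom x₁ y₁ s = F (z₁ s))
    (hK₂ : ∀ s ∈ Ioo t₀ t₁, sphMom x₂ y₂ s = F (z₂ s))
    (hz0 : z₁ 0 = z₂ 0) :
    ∃ θ : ℝ, ∀ s ∈ Ioo t₀ t₁,
      x₂ s = cos θ * x₁ s - sin θ * y₁ s ∧
      y₂ s = sin θ * x₁ s + cos θ * y₁ s ∧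
      z₂ s = z₁ s := by
  have dI : ∀ f : ℝ → ℝ, ContDiffOn ℝ 2 f (Ioo t₀ t₁) →
      ∀ s ∈ Ioo t₀ t₁, DifferentiableAt ℝ f s := fun f hf s hs =>
    (hf.differentiableOn (by norm_num)).differentiableAt (isOpen_Ioo.mem_nhds hs)
  have r₁ := radial (dI _ hx₁) (dI _ hy₁) (dI _ hz₁) hsph₁
  have r₂ := radial (dI _ hx₂) (dI _ hy₂) (dI _ hz₂) hsph₂
  have hzz : ∀ s ∈ Ioo t₀ t₁, z₂ s = z₁ s := by
    refine height_unique (G := fun u => 1 - u ^ 2 - F u ^ 2) (by fun_prop) h0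
      (dI _ hz₁) (dI _ hz₂) hz₁' hz₂' ?_ ?_ hz0
    · intro s hs
      exact height_eq (hsph₁ s hs) (hunit₁ s hs) (r₁ s hs) (hK₁ s hs)
    · intro s hs
      exact height_eq (hsph₂ s hs) (hunit₂ s hs) (r₂ s hs) (hK₂ s hs)
  have hdz : ∀ s ∈ Ioo t₀ t₁, deriv z₂ s = deriv z₁ s := by
    intro s hs
    refine Filter.EventuallyEq.deriv_eq ?_
    filter_upwards [isOpen_Ioo.mem_nhds hs] with r hr using hzz r hr
  have hR : ∀ s ∈ Ioo t₀ t₁, 0 < 1 - z₁ s ^ 2 := by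
    intro s hs
    have := (sq_lt_one_iff_abs_lt_one (z₁ s)).2 (hzlt₁ s hs)
    linarith
  -- the cosine and the sine of the rotation angle, as functions of the parameter
  have hC : ∀ s ∈ Ioo t₀ t₁,
      HasDerivAt (fun s => (x₁ s * x₂ s + y₁ s * y₂ s) / (1 - z₁ s ^ 2)) 0 s ∧
      HasDerivAt (fun s => (x₁ s * y₂ s - y₁ s * x₂ s) / (1 - z₁ s ^ 2)) 0 s := by
    intro s hs
    have a₁ := (dI _ hx₁ s hs).hasDerivAt
    have b₁ := (dI _ hy₁ s hs).hasDerivAt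
    have c₁ := (dI _ hz₁ s hs).hasDerivAt
    have a₂ := (dI _ hx₂ s hs).hasDerivAt
    have b₂ := (dI _ hy₂ s hs).hasDerivAt
    have hr := hR s hs
    have hden := (c₁.pow 2).const_sub 1
    have p₁ := r₁ s hs
    have p₂ := r₂ s hs
    have k₁ := hK₁ s hs
    have k₂ := hK₂ s hs
    have q₁ := hsph₁ s hs
    have q₂ := hsph₂ s hs
    rw [hzz s hs, hdz s hs] at p₂
    rw [hzz s hs] at k₂ q₂
    unfold sphMom at k₁ k₂
    have ex₁ : (1 - z₁ s ^ 2) * deriv x₁ s = -(z₁ s * deriv z₁ s) * x₁ s + F (z₁ s) * y₁ s := by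
      rw [← p₁, ← k₁, ← q₁]; ring
    have ey₁ : (1 - z₁ s ^ 2) * deriv y₁ s = -(z₁ s * deriv z₁ s) * y₁ s - F (z₁ s) * x₁ s := by
      rw [← p₁, ← k₁, ← q₁]; ring
    have ex₂ : (1 - z₁ s ^ 2) * deriv x₂ s = -(z₁ s * deriv z₁ s) * x₂ s + F (z₁ s) * y₂ s := by
      rw [← p₂, ← k₂, ← q₂]; ring
    have ey₂ : (1 - z₁ s ^ 2) * deriv y₂ s = -(z₁ s * deriv z₁ s) * y₂ s - F (z₁ s) * x₂ s := by
      rw [← p₂, ← k₂, ← q₂]; ring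
    constructor
    · refine (((a₁.mul a₂).add (b₁.mul b₂)).div hden hr.ne').congr_deriv ?_
      rw [div_eq_zero_iff]; left
      simp only [Pi.add_apply, Pi.mul_apply, Pi.pow_apply]
      norm_num
      linear_combination x₂ s * ex₁ + x₁ s * ex₂ + y₂ s * ey₁ + y₁ s * ey₂
    · refine (((a₁.mul b₂).sub (b₁.mul a₂)).div hden hr.ne').congr_deriv ?_
      rw [div_eq_zero_iff]; left
      simp only [Pi.sub_apply, Pi.mul_apply, Pi.pow_apply]
      norm_num
      linear_combination y₂ s * ex₁ + x₁ s * ey₂ - x₂ s * ey₁ - y₁ s * ex₂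
  obtain ⟨C, hCc⟩ := isOpen_Ioo.exists_is_const_of_deriv_eq_zero isPreconnected_Ioo
    (fun s hs => (hC s hs).1.differentiableAt.differentiableWithinAt)
    (fun s hs => (hC s hs).1.deriv)
  obtain ⟨S, hSc⟩ := isOpen_Ioo.exists_is_const_of_deriv_eq_zero isPreconnected_Ioo
    (fun s hs => (hC s hs).2.differentiableAt.differentiableWithinAt)
    (fun s hs => (hC s hs).2.deriv)
  have hC' : ∀ s ∈ Ioo t₀ t₁, x₁ s * x₂ s + y₁ s * y₂ s = C * (1 - z₁ s ^ 2) :=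
    fun s hs => (div_eq_iff (hR s hs).ne').1 (hCc s hs)
  have hS' : ∀ s ∈ Ioo t₀ t₁, x₁ s * y₂ s - y₁ s * x₂ s = S * (1 - z₁ s ^ 2) :=
    fun s hs => (div_eq_iff (hR s hs).ne').1 (hSc s hs)
  have hCS : C ^ 2 + S ^ 2 = 1 := by
    have hr := hR 0 h0
    have q₁ : x₁ 0 ^ 2 + y₁ 0 ^ 2 = 1 - z₁ 0 ^ 2 := by linarith [hsph₁ 0 h0]
    have q₂ : x₂ 0 ^ 2 + y₂ 0 ^ 2 = 1 - z₁ 0 ^ 2 := by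
      have := hsph₂ 0 h0
      rw [hzz 0 h0] at this
      linarith
    have e : (x₁ 0 ^ 2 + y₁ 0 ^ 2) * (x₂ 0 ^ 2 + y₂ 0 ^ 2) =
      (x₁ 0 * x₂ 0 + y₁ 0 * y₂ 0) ^ 2 + (x₁ 0 * y₂ 0 - y₁ 0 * x₂ 0) ^ 2 := by ring
    rw [q₁, q₂, hC' 0 h0, hS' 0 h0] at e
    have : (1 - z₁ 0 ^ 2) ^ 2 ≠ 0 := (pow_pos hr 2).ne'
    apply mul_right_cancel₀ this
    linarith
  have hn : ‖(⟨C, S⟩ : ℂ)‖ = 1 := by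
    rw [Complex.norm_eq_sqrt_sq_add_sq, hCS, Real.sqrt_one]
  have hcos := Complex.norm_mul_cos_arg ⟨C, S⟩
  have hsin := Complex.norm_mul_sin_arg ⟨C, S⟩
  rw [hn, one_mul] at hcos hsin
  refine ⟨Complex.arg ⟨C, S⟩, fun s hs => ?_⟩
  rw [hcos, hsin]
  have hr := (hR s hs).ne'
  have q₁ : x₁ s ^ 2 + y₁ s ^ 2 = 1 - z₁ s ^ 2 := by linarith [hsph₁ s hs]
  refine ⟨?_, ?_, hzz s hs⟩
  · apply mul_right_cancel₀ hr
    linear_combination x₁ s * hC' s hs - y₁ s * hS' s hs - x₂ s * q₁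
  · apply mul_right_cancel₀ hr
    linear_combination x₁ s * hS' s hs + y₁ s * hC' s hs - y₂ s * q₁
end

section
/- Let ξ = (x, y, z) : I → ℝ³ be a unit-speed spherical curve on an open interval I, and let a ≠ 0 and b ∈ ℝ. If the geodesic curvature of ξ satisfies κ(s) = 2a·z(s) + b for all s ∈ I, then there exists a constant c ∈ ℝ such that the spherical angular momentum of ξ satisfies 𝒦(s) = a·z(s)² + b·z(s) + c for all s ∈ I. -/
open Real Set

/-- If the geodesic curvature of a unit-speed spherical curve satisfies
`κ = 2a·z + b`, then its angular momentum is `𝒦 = a·z² + b·z + c` for some constant `c`. -/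
theorem momentum_of_linear_curvature (t₀ t₁ : ℝ) (x y z : ℝ → ℝ) (a b : ℝ) (ha : a ≠ 0)
    (hx : ContDiffOn ℝ 2 x (Ioo t₀ t₁)) (hy : ContDiffOn ℝ 2 y (Ioo t₀ t₁))
    (hz : ContDiffOn ℝ 2 z (Ioo t₀ t₁))
    (hsph : ∀ s ∈ Ioo t₀ t₁, x s ^ 2 + y s ^ 2 + z s ^ 2 = 1)
    (hunit : ∀ s ∈ Ioo t₀ t₁, deriv x s ^ 2 + deriv y s ^ 2 + deriv z s ^ 2 = 1)
    (hκ : ∀ s ∈ Ioo t₀ t₁, sphCurv x y z s = 2 * a * z s + b) :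
    ∃ c : ℝ, ∀ s ∈ Ioo t₀ t₁, sphMom x y s = a * z s ^ 2 + b * z s + c := by
  have key : ∀ f : ℝ → ℝ, ContDiffOn ℝ 2 f (Ioo t₀ t₁) → ∀ s ∈ Ioo t₀ t₁,
      HasDerivAt f (deriv f s) s ∧ HasDerivAt (deriv f) (deriv (deriv f) s) s := by
    intro f hf s hs
    have hn : Ioo t₀ t₁ ∈ nhds s := isOpen_Ioo.mem_nhds hs
    have h1 : ContDiffOn ℝ 1 (deriv f) (Ioo t₀ t₁) :=
      hf.deriv_of_isOpen isOpen_Ioo (by norm_num)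
    exact ⟨((hf.contDiffAt hn).differentiableAt (by norm_num)).hasDerivAt,
      ((h1.contDiffAt hn).differentiableAt (by norm_num)).hasDerivAt⟩
  have hconst : ∀ (f : ℝ → ℝ) (c d s : ℝ), s ∈ Ioo t₀ t₁ → (∀ t ∈ Ioo t₀ t₁, f t = c) →
      HasDerivAt f d s → d = 0 := by
    intro f c d s hs hf hd
    have he : f =ᶠ[nhds s] fun _ => c :=
      Filter.eventuallyEq_of_mem (isOpen_Ioo.mem_nhds hs) hf
    exact hd.unique ((hasDerivAt_const s c).congr_of_eventuallyEq he)
  have hder : ∀ s ∈ Ioo t₀ t₁,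
      HasDerivAt (fun s => sphMom x y s - (a * z s ^ 2 + b * z s)) 0 s := by
    intro s hs
    obtain ⟨x1, x2⟩ := key x hx s hs
    obtain ⟨y1, y2⟩ := key y hy s hs
    obtain ⟨z1, z2⟩ := key z hz s hs
    have e1 := hconst _ _ _ s hs hsph (((x1.pow 2).add (y1.pow 2)).add (z1.pow 2))
    have e2 := hconst _ _ _ s hs hunit (((x2.pow 2).add (y2.pow 2)).add (z2.pow 2))
    have e3 := hunit s hs
    have e4 := hκ s hs
    simp [sphCurv, Matrix.det_fin_three] at e4
    have h := ((x2.mul y1).sub (x1.mul y2)).sub (((z1.pow 2).const_mul a).add (z1.const_mul b))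
    refine h.congr_deriv ?_
    norm_num at e1 e2 ⊢
    linear_combination deriv z s * e4
      - (deriv (deriv x) s * y s - x s * deriv (deriv y) s) * e3
      - (1/2) * (deriv x s * deriv (deriv y) s - deriv y s * deriv (deriv x) s) * e1
      - (1/2) * (x s * deriv y s - y s * deriv x s) * e2
  rcases (Ioo t₀ t₁).eq_empty_or_nonempty with h0 | ⟨s₀, hs₀⟩
  · exact ⟨0, fun s hs => by simp [h0] at hs⟩
  · refine ⟨sphMom x y s₀ - (a * z s₀ ^ 2 + b * z s₀), fun s hs => ?_⟩
    have h := isOpen_Ioo.is_const_of_deriv_eq_zero isPreconnected_Ioo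
      (fun t ht => (hder t ht).differentiableAt.differentiableWithinAt)
      (fun t ht => (hder t ht).deriv) hs hs₀
    linarith
end

section
/- Let ξ = (x, y, z) : I → ℝ³ be a unit-speed spherical curve on an open interval I, let a ≠ 0, b, c ∈ ℝ, and suppose its geodesic curvature satisfies κ(s) = 2a·z(s) + b and its spherical angular momentum satisfies 𝒦(s) = a·z(s)² + b·z(s) + c for all s ∈ I. Then κ (as a function of the arc length s) is twice differentiable and satisfies the Euler–Lagrange equation of the functional ∫(κ² − 2bκ + b² − 4ac) ds: 2κ''(s) + κ(s)³ + (2 − (b² − 4ac))·κ(s) − 2b = 0 for all s ∈ I. In particular, if b = 0 then ξ is an elastica under tension σ = −4ac (2κ'' + κ³ + (2 − σ)κ = 0), and if c = 0 then ξ is a λ-elastic curve with λ = −b (2κ'' + κ³ + (2 − λ²)κ + 2λ = 0). -/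
open Real Set

/-- A unit-speed spherical curve with `κ = 2a·z + b` and `𝒦 = a·z² + b·z + c` has a twice
differentiable curvature satisfying the Euler–Lagrange equation
`2κ'' + κ³ + (2 − (b² − 4ac))κ − 2b = 0`; in particular, for `b = 0` it is an elastica under
tension `σ = −4ac`, and for `c = 0` it is a `λ`-elastic curve with `λ = −b`. -/
theorem generalized_elastica_EL (t₀ t₁ : ℝ) (x y z : ℝ → ℝ) (a b c : ℝ) (ha : a ≠ 0)
    (hx : ContDiffOn ℝ 2 x (Ioo t₀ t₁)) (hy : ContDiffOn ℝ 2 y (Ioo t₀ t₁))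
    (hz : ContDiffOn ℝ 2 z (Ioo t₀ t₁))
    (hsph : ∀ s ∈ Ioo t₀ t₁, x s ^ 2 + y s ^ 2 + z s ^ 2 = 1)
    (hunit : ∀ s ∈ Ioo t₀ t₁, deriv x s ^ 2 + deriv y s ^ 2 + deriv z s ^ 2 = 1)
    (hκ : ∀ s ∈ Ioo t₀ t₁, sphCurv x y z s = 2 * a * z s + b)
    (hK : ∀ s ∈ Ioo t₀ t₁, sphMom x y s = a * z s ^ 2 + b * z s + c) :
    (∀ s ∈ Ioo t₀ t₁,
      DifferentiableAt ℝ (sphCurv x y z) s ∧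
      DifferentiableAt ℝ (deriv (sphCurv x y z)) s ∧
      2 * deriv (deriv (sphCurv x y z)) s + sphCurv x y z s ^ 3 +
        (2 - (b ^ 2 - 4 * a * c)) * sphCurv x y z s - 2 * b = 0) ∧
    (b = 0 → ∀ s ∈ Ioo t₀ t₁,
      2 * deriv (deriv (sphCurv x y z)) s + sphCurv x y z s ^ 3 +
        (2 - (-4 * a * c)) * sphCurv x y z s = 0) ∧
    (c = 0 → ∀ s ∈ Ioo t₀ t₁,
      2 * deriv (deriv (sphCurv x y z)) s + sphCurv x y z s ^ 3 +
        (2 - (-b) ^ 2) * sphCurv x y z s + 2 * (-b) = 0) := by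
  have hO : IsOpen (Ioo t₀ t₁) := isOpen_Ioo
  have d1 : ∀ f : ℝ → ℝ, ContDiffOn ℝ 2 f (Ioo t₀ t₁) → ∀ s ∈ Ioo t₀ t₁,
      HasDerivAt f (deriv f s) s ∧ HasDerivAt (deriv f) (deriv (deriv f) s) s := by
    intro f hf s hs
    have hn := hO.mem_nhds hs
    refine ⟨((hf.differentiableOn (by norm_num)).differentiableAt hn).hasDerivAt, ?_⟩
    have h1 : ContDiffOn ℝ 1 (deriv f) (Ioo t₀ t₁) :=
      hf.deriv_of_isOpen hO (by norm_num)
    exact ((h1.differentiableOn (by norm_num)).differentiableAt hn).hasDerivAt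
  have key : ∀ s ∈ Ioo t₀ t₁,
      deriv (deriv z) s = - z s - sphCurv x y z s * sphMom x y s := by
    have hB : ∀ s ∈ Ioo t₀ t₁, x s * deriv x s + y s * deriv y s + z s * deriv z s = 0 := by
      intro s hs
      have h := (((d1 x hx s hs).1.pow 2).add ((d1 y hy s hs).1.pow 2)).add
        ((d1 z hz s hs).1.pow 2)
      have h0 : HasDerivAt (x ^ 2 + y ^ 2 + z ^ 2) 0 s :=
        (hasDerivAt_const s (1 : ℝ)).congr_of_eventuallyEq
          (Filter.eventuallyEq_of_mem (hO.mem_nhds hs) (fun t ht => by simpa using hsph t ht))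
      have := h.unique h0
      norm_num at this
      linarith
    intro s hs
    have hD : x s * deriv (deriv x) s + y s * deriv (deriv y) s + z s * deriv (deriv z) s
        = -1 := by
      have h := (((d1 x hx s hs).1.mul (d1 x hx s hs).2).add
        ((d1 y hy s hs).1.mul (d1 y hy s hs).2)).add
        ((d1 z hz s hs).1.mul (d1 z hz s hs).2)
      have h0 : HasDerivAt (x * deriv x + y * deriv y + z * deriv z) 0 s :=
        (hasDerivAt_const s (0 : ℝ)).congr_of_eventuallyEq
          (Filter.eventuallyEq_of_mem (hO.mem_nhds hs) (fun t ht => by simpa using hB t ht))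
      have := h.unique h0
      have := hunit s hs
      linarith
    have hE : deriv x s * deriv (deriv x) s + deriv y s * deriv (deriv y) s
        + deriv z s * deriv (deriv z) s = 0 := by
      have h := (((d1 x hx s hs).2.pow 2).add ((d1 y hy s hs).2.pow 2)).add
        ((d1 z hz s hs).2.pow 2)
      have h0 : HasDerivAt (deriv x ^ 2 + deriv y ^ 2 + deriv z ^ 2) 0 s :=
        (hasDerivAt_const s (1 : ℝ)).congr_of_eventuallyEq
          (Filter.eventuallyEq_of_mem (hO.mem_nhds hs) (fun t ht => by simpa using hunit t ht))
      have := h.unique h0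
      norm_num at this
      linarith
    have hA := hsph s hs
    have hC := hunit s hs
    have hB := hB s hs
    simp only [sphCurv, sphMom, Matrix.det_fin_three, Matrix.of_apply, Matrix.cons_val]
    generalize deriv (deriv x) s = x2 at *
    generalize deriv (deriv y) s = y2 at *
    generalize deriv (deriv z) s = z2 at *
    generalize deriv x s = x1 at *
    generalize deriv y s = y1 at *
    generalize deriv z s = z1 at *
    generalize x s = x0 at *
    generalize y s = y0 at *
    generalize z s = z0 at *
    have id : z2 * ((x0 ^ 2 + y0 ^ 2 + z0 ^ 2) * (x1 ^ 2 + y1 ^ 2 + z1 ^ 2)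
          - (x0 * x1 + y0 * y1 + z0 * z1) ^ 2)
        = (x0 * x2 + y0 * y2 + z0 * z2) * (z0 * (x1 ^ 2 + y1 ^ 2 + z1 ^ 2)
            - z1 * (x0 * x1 + y0 * y1 + z0 * z1))
          + (x1 * x2 + y1 * y2 + z1 * z2) * (z1 * (x0 ^ 2 + y0 ^ 2 + z0 ^ 2)
            - z0 * (x0 * x1 + y0 * y1 + z0 * z1))
          + (x2 * (y0 * z1 - z0 * y1) + y2 * (z0 * x1 - x0 * z1) + z2 * (x0 * y1 - y0 * x1))
            * (x0 * y1 - y0 * x1) := by ring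
    rw [hA, hB, hC, hD, hE] at id
    linear_combination id
  have hκ1 : ∀ s ∈ Ioo t₀ t₁, HasDerivAt (sphCurv x y z) (2 * a * deriv z s) s := by
    intro s hs
    exact (((d1 z hz s hs).1.const_mul (2 * a)).add_const b).congr_of_eventuallyEq
      (Filter.eventuallyEq_of_mem (hO.mem_nhds hs) (fun t ht => hκ t ht))
  have hκ2 : ∀ s ∈ Ioo t₀ t₁,
      HasDerivAt (deriv (sphCurv x y z)) (2 * a * deriv (deriv z) s) s := by
    intro s hs
    exact ((d1 z hz s hs).2.const_mul (2 * a)).congr_of_eventuallyEq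
      (Filter.eventuallyEq_of_mem (hO.mem_nhds hs) (fun t ht => (hκ1 t ht).deriv))
  have main : ∀ s ∈ Ioo t₀ t₁, 2 * deriv (deriv (sphCurv x y z)) s + sphCurv x y z s ^ 3 +
        (2 - (b ^ 2 - 4 * a * c)) * sphCurv x y z s - 2 * b = 0 := by
    intro s hs
    rw [(hκ2 s hs).deriv, key s hs, hK s hs, hκ s hs]
    ring
  refine ⟨fun s hs => ⟨(hκ1 s hs).differentiableAt, (hκ2 s hs).differentiableAt, main s hs⟩,
    fun hb s hs => ?_, fun hc s hs => ?_⟩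
  · have := main s hs
    subst hb
    linear_combination this
  · have := main s hs
    subst hc
    linear_combination this
end

section
/- Let ξ = (x, y, z) : I → ℝ³ be a unit-speed spherical curve on an open interval I, let a ≠ 0, b, c ∈ ℝ, and suppose its geodesic curvature satisfies κ(s) = 2a·z(s) + b and its spherical angular momentum satisfies 𝒦(s) = a·z(s)² + b·z(s) + c for all s ∈ I. Then the energy first integral holds with explicit value: for every s ∈ I, κ'(s)² + κ(s)⁴/4 + (1 − (b² − 4ac)/2)·κ(s)² − 2b·κ(s) = 4a² − b² − (b² − 4ac)²/4. -/
open Real Set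

/-- Energy first integral with explicit value for the generalized spherical elasticae:
if `κ = 2a·z + b` and `𝒦 = a·z² + b·z + c`, then
`κ'² + κ⁴/4 + (1 − (b² − 4ac)/2)κ² − 2bκ = 4a² − b² − (b² − 4ac)²/4`. -/
theorem generalized_elastica_energy (t₀ t₁ : ℝ) (x y z : ℝ → ℝ) (a b c : ℝ) (ha : a ≠ 0)
    (hx : ContDiffOn ℝ 2 x (Ioo t₀ t₁)) (hy : ContDiffOn ℝ 2 y (Ioo t₀ t₁))
    (hz : ContDiffOn ℝ 2 z (Ioo t₀ t₁))
    (hsph : ∀ s ∈ Ioo t₀ t₁, x s ^ 2 + y s ^ 2 + z s ^ 2 = 1)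
    (hunit : ∀ s ∈ Ioo t₀ t₁, deriv x s ^ 2 + deriv y s ^ 2 + deriv z s ^ 2 = 1)
    (hκ : ∀ s ∈ Ioo t₀ t₁, sphCurv x y z s = 2 * a * z s + b)
    (hK : ∀ s ∈ Ioo t₀ t₁, sphMom x y s = a * z s ^ 2 + b * z s + c) :
    ∀ s ∈ Ioo t₀ t₁,
      deriv (sphCurv x y z) s ^ 2 + sphCurv x y z s ^ 4 / 4 +
        (1 - (b ^ 2 - 4 * a * c) / 2) * sphCurv x y z s ^ 2 - 2 * b * sphCurv x y z s
      = 4 * a ^ 2 - b ^ 2 - (b ^ 2 - 4 * a * c) ^ 2 / 4 := by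
  intro s hs
  have hnhds : Ioo t₀ t₁ ∈ nhds s := isOpen_Ioo.mem_nhds hs
  have dx : HasDerivAt x (deriv x s) s :=
    ((hx.contDiffAt hnhds).differentiableAt (by norm_num)).hasDerivAt
  have dy : HasDerivAt y (deriv y s) s :=
    ((hy.contDiffAt hnhds).differentiableAt (by norm_num)).hasDerivAt
  have dz : HasDerivAt z (deriv z s) s :=
    ((hz.contDiffAt hnhds).differentiableAt (by norm_num)).hasDerivAt
  have hdκ : deriv (sphCurv x y z) s = 2 * a * deriv z s := by
    have he : sphCurv x y z =ᶠ[nhds s] fun t => 2 * a * z t + b :=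
      Filter.eventuallyEq_of_mem hnhds hκ
    rw [he.deriv_eq]
    exact ((dz.const_mul (2 * a)).add_const b).deriv
  have horth : x s * deriv x s + y s * deriv y s + z s * deriv z s = 0 := by
    have he : (fun t => x t ^ 2 + y t ^ 2 + z t ^ 2) =ᶠ[nhds s] fun _ => (1 : ℝ) :=
      Filter.eventuallyEq_of_mem hnhds hsph
    have h1 := he.deriv_eq
    have h2 := (((dx.pow 2).add (dy.pow 2)).add (dz.pow 2)).deriv
    have h3 : deriv (fun t => x t ^ 2 + y t ^ 2 + z t ^ 2) s = _ := h2
    rw [h3] at h1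
    simp at h1
    linarith
  have hKs := hK s hs
  have h1 := hsph s hs
  have h2 := hunit s hs
  have hz2 : deriv z s ^ 2 = 1 - z s ^ 2 - sphMom x y s ^ 2 := by
    unfold sphMom
    have e1 : x s * deriv x s + y s * deriv y s = - (z s * deriv z s) := by linarith
    have e2 : x s ^ 2 + y s ^ 2 = 1 - z s ^ 2 := by linarith
    have e3 : deriv x s ^ 2 + deriv y s ^ 2 = 1 - deriv z s ^ 2 := by linarith
    have e4 : (deriv x s * y s - x s * deriv y s) ^ 2
        + (x s * deriv x s + y s * deriv y s) ^ 2
        = (x s ^ 2 + y s ^ 2) * (deriv x s ^ 2 + deriv y s ^ 2) := by ring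
    rw [e1, e2, e3] at e4
    linarith
  rw [hKs] at hz2
  rw [hdκ, hκ s hs]
  linear_combination 4 * a ^ 2 * hz2
end

section
/- Let ξ = (x, y, z) : I → ℝ³ be a unit-speed spherical curve on an open interval I with z'(s) ≠ 0 for all s ∈ I, let a ≠ 0 and c ∈ ℝ, and suppose its spherical angular momentum satisfies 𝒦(s) = a·z(s)² + c for all s ∈ I. Then its geodesic curvature satisfies κ(s) = 2a·z(s) for all s ∈ I, and κ satisfies the elastica equation under tension σ = −4ac: 2κ''(s) + κ(s)³ + (2 + 4ac)·κ(s) = 0 for all s ∈ I. (The elasticae under tension σ are the only spherical curves, up to rotations around the z-axis, with spherical angular momentum 𝒦(z) = a·z² + c, σ = −4ac.) -/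
open Real Set

lemma sph_alg (x y z p q w r t u : ℝ) (h1 : x ^ 2 + y ^ 2 + z ^ 2 = 1)
    (h2 : p ^ 2 + q ^ 2 + w ^ 2 = 1) (h3 : x * p + y * q + z * w = 0)
    (h4 : p * r + q * t + w * u = 0) (h5 : x * r + y * t + z * u = -1) (κ : ℝ)
    (hκ : κ = x * q * u - x * w * t - y * p * u + y * w * r + z * p * t - z * q * r) :
    κ * w = r * y - x * t ∧ u = - z - κ * (p * y - x * q) := by
  subst hκ
  constructor
  · linear_combination (p * t - q * r) * h3 + (r * y - x * t) * h2 + (x * q - y * p) * h4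
  · have key : ((x ^ 2 + y ^ 2 + z ^ 2) * (p ^ 2 + q ^ 2 + w ^ 2)
        - (x * p + y * q + z * w) ^ 2) * u
        = (x * r + y * t + z * u) * (z * (p ^ 2 + q ^ 2 + w ^ 2) - w * (x * p + y * q + z * w))
        + (p * r + q * t + w * u) * (w * (x ^ 2 + y ^ 2 + z ^ 2) - z * (x * p + y * q + z * w))
        + (x * q * u - x * w * t - y * p * u + y * w * r + z * p * t - z * q * r)
          * (x * q - p * y) := by ring
    rw [h1, h2, h3, h4, h5] at key
    linear_combination key

lemma sph_derivs {t₀ t₁ : ℝ} {f : ℝ → ℝ} (hf : ContDiffOn ℝ 2 f (Ioo t₀ t₁)) {s : ℝ}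
    (hs : s ∈ Ioo t₀ t₁) : HasDerivAt f (deriv f s) s ∧
      HasDerivAt (deriv f) (deriv (deriv f) s) s := by
  have hn := isOpen_Ioo.mem_nhds hs
  refine ⟨((hf.differentiableOn (by norm_num)).differentiableAt hn).hasDerivAt, ?_⟩
  have h2 : ContDiffOn ℝ 1 (deriv f) (Ioo t₀ t₁) :=
    hf.deriv_of_isOpen isOpen_Ioo (by norm_num)
  exact ((h2.differentiableOn (by norm_num)).differentiableAt hn).hasDerivAt

lemma sph_uniq {t₀ t₁ : ℝ} {f g : ℝ → ℝ} (h : ∀ s ∈ Ioo t₀ t₁, f s = g s) {s f' g' : ℝ}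
    (hs : s ∈ Ioo t₀ t₁) (hf : HasDerivAt f f' s) (hg : HasDerivAt g g' s) : f' = g' :=
  hf.unique (hg.congr_of_eventuallyEq
    (Filter.eventually_of_mem (isOpen_Ioo.mem_nhds hs) h))

/-- A unit-speed spherical curve with nonconstant `z` and angular momentum
`𝒦 = a·z² + c` has curvature `κ = 2a·z` and is an elastica under tension `σ = −4ac`:
`2κ'' + κ³ + (2 + 4ac)κ = 0`. -/
theorem elastica_characterization (t₀ t₁ : ℝ) (x y z : ℝ → ℝ) (a c : ℝ) (ha : a ≠ 0)
    (hx : ContDiffOn ℝ 2 x (Ioo t₀ t₁)) (hy : ContDiffOn ℝ 2 y (Ioo t₀ t₁))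
    (hz : ContDiffOn ℝ 2 z (Ioo t₀ t₁))
    (hsph : ∀ s ∈ Ioo t₀ t₁, x s ^ 2 + y s ^ 2 + z s ^ 2 = 1)
    (hunit : ∀ s ∈ Ioo t₀ t₁, deriv x s ^ 2 + deriv y s ^ 2 + deriv z s ^ 2 = 1)
    (hz' : ∀ s ∈ Ioo t₀ t₁, deriv z s ≠ 0)
    (hK : ∀ s ∈ Ioo t₀ t₁, sphMom x y s = a * z s ^ 2 + c) :
    (∀ s ∈ Ioo t₀ t₁, sphCurv x y z s = 2 * a * z s) ∧
    (∀ s ∈ Ioo t₀ t₁,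
      2 * deriv (deriv (sphCurv x y z)) s + sphCurv x y z s ^ 3 +
        (2 + 4 * a * c) * sphCurv x y z s = 0) := by
  have hdot : ∀ s ∈ Ioo t₀ t₁,
      x s * deriv x s + y s * deriv y s + z s * deriv z s = 0 := by
    intro s hs
    have hX := (sph_derivs hx hs).1
    have hY := (sph_derivs hy hs).1
    have hZ := (sph_derivs hz hs).1
    have := sph_uniq hsph hs (((hX.fun_pow 2).fun_add (hY.fun_pow 2)).fun_add (hZ.fun_pow 2))
      (hasDerivAt_const s 1)
    norm_num at this
    linarith
  have main : ∀ s ∈ Ioo t₀ t₁, sphCurv x y z s = 2 * a * z s ∧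
      deriv (deriv z) s = - z s - sphCurv x y z s * (a * z s ^ 2 + c) := by
    intro s hs
    obtain ⟨hX, hX'⟩ := sph_derivs hx hs
    obtain ⟨hY, hY'⟩ := sph_derivs hy hs
    obtain ⟨hZ, hZ'⟩ := sph_derivs hz hs
    have e4 := sph_uniq hunit hs
      (((hX'.fun_pow 2).fun_add (hY'.fun_pow 2)).fun_add (hZ'.fun_pow 2))
      (hasDerivAt_const s 1)
    have e5 := sph_uniq hdot hs
      (((hX.fun_mul hX').fun_add (hY.fun_mul hY')).fun_add (hZ.fun_mul hZ'))
      (hasDerivAt_const s 0)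
    have e6 := sph_uniq hK hs ((hX'.fun_mul hY).fun_sub (hX.fun_mul hY'))
      (((hZ.fun_pow 2).const_mul a).add_const c)
    norm_num at e4 e6
    have e2 := hunit s hs
    obtain ⟨k1, k2⟩ := sph_alg (x s) (y s) (z s) (deriv x s) (deriv y s) (deriv z s)
      (deriv (deriv x) s) (deriv (deriv y) s) (deriv (deriv z) s) (hsph s hs) e2
      (hdot s hs) (by linarith) (by linarith) (sphCurv x y z s)
      (by simp only [sphCurv, Matrix.det_fin_three]; simp; try ring)
    refine ⟨mul_right_cancel₀ (hz' s hs) ?_, ?_⟩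
    · rw [k1]; linarith
    · have := hK s hs
      unfold sphMom at this
      rw [← this]; exact k2
  refine ⟨fun s hs => (main s hs).1, fun s hs => ?_⟩
  have d1 : ∀ s ∈ Ioo t₀ t₁, deriv (sphCurv x y z) s = 2 * a * deriv z s := fun s hs =>
    (((sph_derivs hz hs).1.const_mul (2 * a)).congr_of_eventuallyEq
      (Filter.eventually_of_mem (isOpen_Ioo.mem_nhds hs) fun s hs => (main s hs).1)).deriv
  have d2 : deriv (deriv (sphCurv x y z)) s = 2 * a * deriv (deriv z) s :=
    (((sph_derivs hz hs).2.const_mul (2 * a)).congr_of_eventuallyEq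
      (Filter.eventually_of_mem (isOpen_Ioo.mem_nhds hs) d1)).deriv
  rw [d2, (main s hs).2, (main s hs).1]
  ring
end

section
/- The curve ξ(s) = (tanh s·cos s, tanh s·sin s, sech s), s ∈ ℝ, is a unit-speed spherical curve whose spherical angular momentum satisfies 𝒦(s) = z(s)² − 1 = −tanh²s and whose geodesic curvature satisfies κ(s) = 2·z(s) = 2·sech s, where z(s) = sech s is its third coordinate. (This is the borderline elastica with a = 1, equivalently the Seiffert spiral with modulus p = 1; it is asymptotic to the equator z = 0.) -/
open Real Set

lemma be_sq (s : ℝ) : Real.tanh s ^ 2 + (1 / Real.cosh s) ^ 2 = 1 := by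
  have h := (Real.cosh_pos s).ne'
  have h2 := Real.cosh_sq s
  rw [Real.tanh_eq_sinh_div_cosh]
  field_simp
  linarith

lemma be_tanh (s : ℝ) : HasDerivAt Real.tanh ((1 / Real.cosh s) ^ 2) s := by
  have h := (Real.cosh_pos s).ne'
  have h2 := Real.cosh_sq s
  have e : Real.tanh = fun s => Real.sinh s / Real.cosh s :=
    funext Real.tanh_eq_sinh_div_cosh
  rw [e]
  refine HasDerivAt.congr_deriv ((Real.hasDerivAt_sinh s).fun_div (Real.hasDerivAt_cosh s) h) ?_
  field_simp
  linarith

lemma be_sech (s : ℝ) :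
    HasDerivAt (fun s => 1 / Real.cosh s) (-(Real.tanh s * (1 / Real.cosh s))) s := by
  have h := (Real.cosh_pos s).ne'
  refine HasDerivAt.congr_deriv ((hasDerivAt_const s (1 : ℝ)).fun_div (Real.hasDerivAt_cosh s) h) ?_
  rw [Real.tanh_eq_sinh_div_cosh]
  field_simp
  ring

/-- The borderline elastica (Seiffert spiral with modulus `p = 1`)
`ξ(s) = (tanh s · cos s, tanh s · sin s, sech s)` is a unit-speed spherical curve with
`𝒦(s) = z(s)² − 1 = −tanh²s` and `κ(s) = 2·z(s) = 2·sech s`. -/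
theorem borderline_elastica :
    let x : ℝ → ℝ := fun s => Real.tanh s * cos s
    let y : ℝ → ℝ := fun s => Real.tanh s * sin s
    let z : ℝ → ℝ := fun s => 1 / Real.cosh s
    (∀ s : ℝ, x s ^ 2 + y s ^ 2 + z s ^ 2 = 1) ∧
    (∀ s : ℝ, deriv x s ^ 2 + deriv y s ^ 2 + deriv z s ^ 2 = 1) ∧
    (∀ s : ℝ, sphMom x y s = z s ^ 2 - 1 ∧ sphMom x y s = -Real.tanh s ^ 2) ∧
    (∀ s : ℝ, sphCurv x y z s = 2 * z s ∧ sphCurv x y z s = 2 / Real.cosh s) := by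
  intro x y z
  have dx : deriv x = fun s => (1 / Real.cosh s) ^ 2 * cos s - Real.tanh s * sin s := by
    funext s
    refine HasDerivAt.deriv ?_
    refine HasDerivAt.congr_deriv ((be_tanh s).fun_mul (Real.hasDerivAt_cos s)) ?_
    ring
  have dy : deriv y = fun s => (1 / Real.cosh s) ^ 2 * sin s + Real.tanh s * cos s := by
    funext s
    exact ((be_tanh s).fun_mul (Real.hasDerivAt_sin s)).deriv
  have dz : deriv z = fun s => -(Real.tanh s * (1 / Real.cosh s)) := by
    funext s
    exact (be_sech s).deriv
  have ddx : ∀ s, deriv (deriv x) s = -2 * Real.tanh s * (1 / Real.cosh s) ^ 2 * cos s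
      - 2 * (1 / Real.cosh s) ^ 2 * sin s - Real.tanh s * cos s := by
    intro s
    rw [dx]
    refine HasDerivAt.deriv ?_
    refine HasDerivAt.congr_deriv ((((be_sech s).fun_pow 2).fun_mul (Real.hasDerivAt_cos s)).fun_sub
      ((be_tanh s).fun_mul (Real.hasDerivAt_sin s))) ?_
    push_cast
    ring
  have ddy : ∀ s, deriv (deriv y) s = -2 * Real.tanh s * (1 / Real.cosh s) ^ 2 * sin s
      + 2 * (1 / Real.cosh s) ^ 2 * cos s - Real.tanh s * sin s := by
    intro s
    rw [dy]
    refine HasDerivAt.deriv ?_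
    refine HasDerivAt.congr_deriv ((((be_sech s).fun_pow 2).fun_mul (Real.hasDerivAt_sin s)).fun_add
      ((be_tanh s).fun_mul (Real.hasDerivAt_cos s))) ?_
    push_cast
    ring
  have ddz : ∀ s, deriv (deriv z) s =
      Real.tanh s ^ 2 * (1 / Real.cosh s) - (1 / Real.cosh s) ^ 3 := by
    intro s
    rw [dz]
    refine HasDerivAt.deriv ?_
    refine HasDerivAt.congr_deriv (((be_tanh s).fun_mul (be_sech s)).fun_neg) ?_
    ring
  have mom : ∀ s, sphMom x y s = -Real.tanh s ^ 2 := by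
    intro s
    have h1 := Real.sin_sq_add_cos_sq s
    simp only [sphMom, dx, dy, x, y]
    linear_combination (-Real.tanh s ^ 2) * h1
  have curv : ∀ s, sphCurv x y z s = 2 * (1 / Real.cosh s) := by
    intro s
    have h1 := Real.sin_sq_add_cos_sq s
    have h2 := be_sq s
    simp only [sphCurv, Matrix.det_fin_three, ddx, ddy, ddz]
    simp only [dx, dy, dz, x, y, z, Matrix.of_apply, Matrix.cons_val', Matrix.cons_val]
    generalize 1 / Real.cosh s = C at *
    generalize Real.tanh s = T at *
    generalize Real.sin s = S at *
    generalize Real.cos s = c at *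
    linear_combination (T * (T * (T^2*C - C^3) + 2*T*C^3) + C*(2*C^4 + 2*T^2*C^2 + T^2)) * h1
      + (T^2*C + 2*C^3 + 2*C) * h2
  refine ⟨fun s => ?_, fun s => ?_, fun s => ⟨?_, mom s⟩, fun s => ⟨curv s, ?_⟩⟩
  · have h1 := Real.sin_sq_add_cos_sq s
    have h2 := be_sq s
    simp only [x, y, z]
    linear_combination Real.tanh s ^ 2 * h1 + h2
  · have h1 := Real.sin_sq_add_cos_sq s
    have h2 := be_sq s
    simp only [dx, dy, dz]
    generalize 1 / Real.cosh s = C at *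
    generalize Real.tanh s = T at *
    linear_combination (C^4 + T^2) * h1 + (C^2 + 1) * h2
  · rw [mom s]
    simp only [z]
    linear_combination -be_sq s
  · rw [curv s]
    ring
end

section
/- Let α ∈ (0, π/2) and let I = (−π/(2 sin α), π/(2 sin α)). Define φ(s) = (sin α)·s and λ(s) = (cos α/sin α)·log(1/cos φ(s) + tan φ(s)) for s ∈ I, and set ξ(s) = (cos φ(s)·cos λ(s), cos φ(s)·sin λ(s), sin φ(s)). Then ξ is a unit-speed spherical curve satisfying the loxodrome (rhumb line) equation λ'(s) = (cos α/sin α)·φ'(s)/cos φ(s); its spherical angular momentum is 𝒦(s) = −cos α·cos φ(s), and its geodesic curvature is κ(s) = cos α·tan((sin α)·s) for all s ∈ I. -/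
open Real Set

/-- The explicit loxodrome of angle `α`: with `φ(s) = sin α · s` and
`λ(s) = (cos α/sin α)·log(sec φ + tan φ)`, the curve
`ξ = (cos φ cos λ, cos φ sin λ, sin φ)` is a unit-speed spherical curve satisfying the
rhumb-line equation `λ' = (cos α/sin α)·φ'/cos φ`, with `𝒦 = −cos α · cos φ` and
`κ(s) = cos α · tan(sin α · s)`. -/
theorem loxodrome_explicit (α : ℝ) (hα : α ∈ Ioo 0 (π / 2)) :
    let φ : ℝ → ℝ := fun s => sin α * s
    let lam : ℝ → ℝ := fun s => (cos α / sin α) * Real.log (1 / cos (φ s) + tan (φ s))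
    let x : ℝ → ℝ := fun s => cos (φ s) * cos (lam s)
    let y : ℝ → ℝ := fun s => cos (φ s) * sin (lam s)
    let z : ℝ → ℝ := fun s => sin (φ s)
    ∀ s ∈ Ioo (-(π / (2 * sin α))) (π / (2 * sin α)),
      x s ^ 2 + y s ^ 2 + z s ^ 2 = 1 ∧
      deriv x s ^ 2 + deriv y s ^ 2 + deriv z s ^ 2 = 1 ∧
      deriv lam s = (cos α / sin α) * deriv φ s / cos (φ s) ∧
      sphMom x y s = -cos α * cos (φ s) ∧
      sphCurv x y z s = cos α * tan (sin α * s) := by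
  intro φ lam x y z
  have ha : 0 < sin α := sin_pos_of_pos_of_lt_pi hα.1 (by linarith [hα.2, pi_pos])
  set a := sin α with ha_def
  set c := cos α with hc_def
  have hac : a ^ 2 + c ^ 2 = 1 := sin_sq_add_cos_sq α
  have hC : ∀ s ∈ Ioo (-(π / (2 * a))) (π / (2 * a)), 0 < cos (a * s) := by
    intro s hs
    have e : a * (π / (2 * a)) = π / 2 := by field_simp
    apply cos_pos_of_mem_Ioo
    constructor
    · have := mul_lt_mul_of_pos_left hs.1 ha
      linarith
    · have := mul_lt_mul_of_pos_left hs.2 ha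
      linarith
  have dφ : ∀ s, HasDerivAt φ a s := fun s => by
    simpa using (hasDerivAt_id s).const_mul a
  have dC : ∀ s, HasDerivAt (fun s => cos (φ s)) (-sin (φ s) * a) s := fun s => (dφ s).cos
  have dS : ∀ s, HasDerivAt (fun s => sin (φ s)) (cos (φ s) * a) s := fun s => (dφ s).sin
  have dlam : ∀ s ∈ Ioo (-(π / (2 * a))) (π / (2 * a)), HasDerivAt lam (c / cos (φ s)) s := by
    intro s hs
    have hc : 0 < cos (φ s) := hC s hs
    have hsc := sin_sq_add_cos_sq (φ s)
    have hS : 0 < 1 + sin (φ s) := by nlinarith [neg_one_le_sin (φ s)]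
    have hne : 1 / cos (φ s) + tan (φ s) ≠ 0 := by
      rw [tan_eq_sin_div_cos, ← add_div]; positivity
    have h1 : HasDerivAt (fun s => 1 / cos (φ s) + tan (φ s)) _ s :=
      ((hasDerivAt_const s (1:ℝ)).div (dC s) hc.ne').add
        ((hasDerivAt_tan hc.ne').comp s (dφ s))
    have h2 := (h1.log hne).const_mul (c / a)
    refine h2.congr_deriv ?_
    rw [tan_eq_sin_div_cos]
    field_simp
    ring
  have dx : ∀ s ∈ Ioo (-(π / (2 * a))) (π / (2 * a)),
      HasDerivAt x (-a * sin (φ s) * cos (lam s) - c * sin (lam s)) s := by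
    intro s hs
    have hc : cos (φ s) ≠ 0 := (hC s hs).ne'
    refine ((dC s).mul (dlam s hs).cos).congr_deriv ?_
    field_simp
    ring
  have dy : ∀ s ∈ Ioo (-(π / (2 * a))) (π / (2 * a)),
      HasDerivAt y (-a * sin (φ s) * sin (lam s) + c * cos (lam s)) s := by
    intro s hs
    have hc : cos (φ s) ≠ 0 := (hC s hs).ne'
    refine ((dC s).mul (dlam s hs).sin).congr_deriv ?_
    field_simp
  have dz : deriv z = fun s => cos (φ s) * a := funext fun s => (dS s).deriv
  intro s hs
  have hc : cos (φ s) ≠ 0 := (hC s hs).ne'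
  have hnhds := Ioo_mem_nhds hs.1 hs.2
  have ex : deriv x =ᶠ[nhds s] fun s => -a * sin (φ s) * cos (lam s) - c * sin (lam s) := by
    filter_upwards [hnhds] with t ht using (dx t ht).deriv
  have ey : deriv y =ᶠ[nhds s] fun s => -a * sin (φ s) * sin (lam s) + c * cos (lam s) := by
    filter_upwards [hnhds] with t ht using (dy t ht).deriv
  have ddx := ex.deriv_eq.trans ((((dS s).const_mul (-a)).mul (dlam s hs).cos).sub
    ((dlam s hs).sin.const_mul c)).deriv
  have ddy := ey.deriv_eq.trans ((((dS s).const_mul (-a)).mul (dlam s hs).sin).add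
    ((dlam s hs).cos.const_mul c)).deriv
  have ddz : deriv (deriv z) s = -sin (φ s) * a * a := by
    rw [dz]; exact ((dC s).mul_const a).deriv
  have hz : deriv z s = cos (φ s) * a := (dS s).deriv
  have h1 := sin_sq_add_cos_sq (φ s)
  have h2 := sin_sq_add_cos_sq (lam s)
  have hx0 : x s = cos (φ s) * cos (lam s) := rfl
  have hy0 : y s = cos (φ s) * sin (lam s) := rfl
  have hz0 : z s = sin (φ s) := rfl
  have ht : tan (a * s) = sin (φ s) / cos (φ s) := tan_eq_sin_div_cos _
  unfold sphMom sphCurv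
  rw [Matrix.det_fin_three]
  simp only [Matrix.of_apply, Matrix.cons_val', Matrix.cons_val_zero, Matrix.cons_val_one,
    Matrix.cons_val]
  rw [ddx, ddy, ddz, (dx s hs).deriv, (dy s hs).deriv, hz, (dlam s hs).deriv, (dφ s).deriv,
    hx0, hy0, hz0, ht]
  clear_value φ lam a c
  generalize cos (φ s) = C at *
  generalize sin (φ s) = S at *
  generalize cos (lam s) = L at *
  generalize sin (lam s) = M at *
  refine ⟨?_, ?_, ?_, ?_, ?_⟩
  · linear_combination C ^ 2 * h2 + h1
  · linear_combination (a ^ 2 * S ^ 2 + c ^ 2) * h2 + a ^ 2 * h1 + hac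
  · field_simp
  · linear_combination (-c * C) * h2
  · field_simp
    linear_combination S * c * (a ^ 2 * C ^ 2 + a ^ 2 * S ^ 2 + c ^ 2) * h2 + S * c * a ^ 2 * h1 + S * c * hac
end

section
/- Let α ∈ (0, π/2), let φ, λ : I → ℝ be differentiable on an open interval I with φ(s) ∈ (−π/2, π/2) and φ'(s) > 0 for all s, and suppose ξ(s) = (cos φ(s)·cos λ(s), cos φ(s)·sin λ(s), sin φ(s)) satisfies ‖ξ'(s)‖ = 1 and has spherical angular momentum 𝒦(s) = −cos α·cos φ(s) for all s ∈ I. Then φ'(s) = sin α and λ'(s) = (cos α/sin α)·φ'(s)/cos φ(s) for all s ∈ I; that is, ξ is a loxodrome of angle α. (The loxodromes are the only spherical curves, up to rotations around the z-axis, with spherical angular momentum 𝒦(φ) = −cos α·cos φ.) -/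
open Real Set

/-- Uniqueness of loxodromes: a unit-speed spherical curve in geographical coordinates
`(φ, λ)` with increasing latitude and angular momentum `𝒦 = −cos α · cos φ` satisfies
`φ' = sin α` and the rhumb-line equation `λ' = (cos α/sin α)·φ'/cos φ`. -/
theorem loxodrome_uniqueness (α : ℝ) (hα : α ∈ Ioo 0 (π / 2))
    (t₀ t₁ : ℝ) (φ lam : ℝ → ℝ)
    (hφ : ∀ s ∈ Ioo t₀ t₁, DifferentiableAt ℝ φ s)
    (hlam : ∀ s ∈ Ioo t₀ t₁, DifferentiableAt ℝ lam s)
    (hrange : ∀ s ∈ Ioo t₀ t₁, φ s ∈ Ioo (-(π / 2)) (π / 2))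
    (hφ' : ∀ s ∈ Ioo t₀ t₁, deriv φ s > 0)
    (hunit : ∀ s ∈ Ioo t₀ t₁,
      deriv (fun t => cos (φ t) * cos (lam t)) s ^ 2 +
      deriv (fun t => cos (φ t) * sin (lam t)) s ^ 2 +
      deriv (fun t => sin (φ t)) s ^ 2 = 1)
    (hK : ∀ s ∈ Ioo t₀ t₁,
      sphMom (fun t => cos (φ t) * cos (lam t)) (fun t => cos (φ t) * sin (lam t)) s
        = -cos α * cos (φ s)) :
    ∀ s ∈ Ioo t₀ t₁,
      deriv φ s = sin α ∧
      deriv lam s = (cos α / sin α) * deriv φ s / cos (φ s) := by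
  intro s hs
  have dφ := (hφ s hs).hasDerivAt
  have dl := (hlam s hs).hasDerivAt
  have h1 := (dφ.cos.mul dl.cos).deriv
  have h2 := (dφ.cos.mul dl.sin).deriv
  have h3 := dφ.sin.deriv
  have hu := hunit s hs
  have hk := hK s hs
  have hp := hφ' s hs
  have hc : 0 < cos (φ s) := cos_pos_of_mem_Ioo (hrange s hs)
  have hsα : 0 < sin α := sin_pos_of_pos_of_lt_pi hα.1 (by linarith [hα.2, pi_pos])
  change deriv (fun t => cos (φ t) * cos (lam t)) s = _ at h1
  change deriv (fun t => cos (φ t) * sin (lam t)) s = _ at h2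
  unfold sphMom at hk
  rw [h1, h2] at hk
  rw [h1, h2, h3] at hu
  have e1 := sin_sq_add_cos_sq (φ s)
  have e2 := sin_sq_add_cos_sq (lam s)
  have e3 := sin_sq_add_cos_sq α
  generalize deriv φ s = p at *
  generalize deriv lam s = q at *
  have hk' : cos (φ s) * (cos (φ s) * q) = cos (φ s) * cos α := by
    linear_combination -hk - cos (φ s) ^ 2 * q * e2
  have hq : cos (φ s) * q = cos α := mul_left_cancel₀ hc.ne' hk'
  have hu' : p ^ 2 + (cos (φ s) * q) ^ 2 = 1 := by
    linear_combination hu - (sin (φ s) ^ 2 * p ^ 2 + cos (φ s) ^ 2 * q ^ 2) * e2 - p ^ 2 * e1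
  have hp2 : p ^ 2 = sin α ^ 2 := by
    rw [hq] at hu'
    linarith
  have hpe : p = sin α := by
    rcases sq_eq_sq_iff_eq_or_eq_neg.mp hp2 with h | h
    · exact h
    · linarith
  refine ⟨hpe, ?_⟩
  rw [hpe, div_mul_cancel₀ _ hsα.ne', eq_div_iff hc.ne']
  linarith
end

section
/- Let 0 < a < 1/2 and define z(s) = √((1 + √(1 − 4a²)·sin 2s)/2) for s ∈ ℝ; then 0 < z(s) < 1 for all s. Let λ : ℝ → ℝ be differentiable with λ'(s) = a/(z(s)·(1 − z(s)²)), and set ξ(s) = (√(1 − z(s)²)·cos λ(s), √(1 − z(s)²)·sin λ(s), z(s)). Then ξ is a unit-speed spherical curve satisfying the catenary first integral z(s)·(1 − z(s)²)·λ'(s) = a for all s; its spherical angular momentum is 𝒦(s) = −a/z(s), and its geodesic curvature is κ(s) = a/z(s)² = 2a/(1 + √(1 − 4a²)·sin 2s) for all s ∈ ℝ. (The spherical catenaries are the only spherical curves, up to rotations around the z-axis, with spherical angular momentum 𝒦(z) = −a/z, 0 < a < 1/2.) -/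
open Real Set

/-- The spherical catenary: with `z(s) = √((1 + √(1−4a²)·sin 2s)/2)` and
`λ' = a/(z(1−z²))`, the curve `ξ = (√(1−z²)cos λ, √(1−z²)sin λ, z)` is a unit-speed
spherical curve with catenary first integral `z(1−z²)λ' = a`, angular momentum
`𝒦 = −a/z` and curvature `κ = a/z² = 2a/(1 + √(1−4a²)·sin 2s)`. -/
theorem spherical_catenary (a : ℝ) (ha : 0 < a) (ha' : a < 1 / 2)
    (z lam : ℝ → ℝ) (hlamdiff : Differentiable ℝ lam)
    (hzdef : ∀ s : ℝ, z s = Real.sqrt ((1 + Real.sqrt (1 - 4 * a ^ 2) * sin (2 * s)) / 2))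
    (hlam' : ∀ s : ℝ, deriv lam s = a / (z s * (1 - z s ^ 2))) :
    let x : ℝ → ℝ := fun s => Real.sqrt (1 - z s ^ 2) * cos (lam s)
    let y : ℝ → ℝ := fun s => Real.sqrt (1 - z s ^ 2) * sin (lam s)
    (∀ s : ℝ, 0 < z s ∧ z s < 1) ∧
    (∀ s : ℝ, x s ^ 2 + y s ^ 2 + z s ^ 2 = 1) ∧
    (∀ s : ℝ, deriv x s ^ 2 + deriv y s ^ 2 + deriv z s ^ 2 = 1) ∧
    (∀ s : ℝ, z s * (1 - z s ^ 2) * deriv lam s = a) ∧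
    (∀ s : ℝ, sphMom x y s = -a / z s) ∧
    (∀ s : ℝ, sphCurv x y z s = a / z s ^ 2 ∧
      sphCurv x y z s = 2 * a / (1 + Real.sqrt (1 - 4 * a ^ 2) * sin (2 * s))) := by
  intro x y
  have hcpos : 0 ≤ 1 - 4 * a ^ 2 := by nlinarith
  have hc0 : 0 ≤ Real.sqrt (1 - 4 * a ^ 2) := Real.sqrt_nonneg _
  have hc2 : Real.sqrt (1 - 4 * a ^ 2) ^ 2 = 1 - 4 * a ^ 2 := Real.sq_sqrt hcpos
  generalize Real.sqrt (1 - 4 * a ^ 2) = c at *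
  have hc1 : c < 1 := by nlinarith
  have hpm : ∀ s : ℝ, 0 < 1 + c * sin (2 * s) ∧ 0 < 1 - c * sin (2 * s) := by
    intro s
    have h1 := Real.sin_le_one (2 * s)
    have h2 := Real.neg_one_le_sin (2 * s)
    constructor <;> nlinarith
  have hz2 : ∀ s, z s ^ 2 = (1 + c * sin (2 * s)) / 2 := by
    intro s
    rw [hzdef s]
    exact Real.sq_sqrt (by linarith [(hpm s).1])
  have hz0 : ∀ s, 0 < z s := by
    intro s
    rw [hzdef s]
    exact Real.sqrt_pos.mpr (by linarith [(hpm s).1])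
  have hr2pos : ∀ s, 0 < 1 - z s ^ 2 := by
    intro s
    rw [hz2 s]
    linarith [(hpm s).2]
  have hz1 : ∀ s, z s < 1 := by
    intro s
    nlinarith [hr2pos s, hz0 s]
  obtain ⟨r, hr⟩ : ∃ r : ℝ → ℝ, r = fun s => Real.sqrt (1 - z s ^ 2) := ⟨_, rfl⟩
  have hr2 : ∀ s, r s ^ 2 = 1 - z s ^ 2 := by
    intro s
    rw [hr]
    exact Real.sq_sqrt (hr2pos s).le
  have hr0 : ∀ s, 0 < r s := by
    intro s
    rw [hr]
    exact Real.sqrt_pos.mpr (hr2pos s)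
  have hx : x = fun s => r s * cos (lam s) := by rw [hr]
  have hy : y = fun s => r s * sin (lam s) := by rw [hr]
  clear_value x y
  have hsin : ∀ s : ℝ, HasDerivAt (fun s => sin (2 * s)) (2 * cos (2 * s)) s := by
    intro s
    have := ((hasDerivAt_id s).const_mul 2).sin
    simp only [id, mul_one] at this
    convert this using 1
    ring
  have hcos : ∀ s : ℝ, HasDerivAt (fun s => cos (2 * s)) (-2 * sin (2 * s)) s := by
    intro s
    have := ((hasDerivAt_id s).const_mul 2).cos
    simp only [id, mul_one] at this
    convert this using 1
    ring
  obtain ⟨w, hw⟩ : ∃ w : ℝ → ℝ, w = fun s => c * cos (2 * s) / (2 * z s) := ⟨_, rfl⟩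
  have hzw : ∀ s, z s * w s = c * cos (2 * s) / 2 := by
    intro s
    have := (hz0 s).ne'
    rw [hw]
    field_simp
  have hdz : ∀ s, HasDerivAt z (w s) s := by
    intro s
    have h := ((((hsin s).const_mul c).const_add 1).div_const 2).sqrt
      (div_pos (hpm s).1 two_pos).ne'
    have hzf : z = fun s => Real.sqrt ((1 + c * sin (2 * s)) / 2) := funext hzdef
    rw [← hzdef s, ← hzf] at h
    convert h using 1
    rw [hw]
    have := (hz0 s).ne'
    field_simp
  obtain ⟨v, hv⟩ : ∃ v : ℝ → ℝ, v = fun s => -(z s * w s) / r s := ⟨_, rfl⟩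
  have hrv : ∀ s, r s * v s = -(z s * w s) := by
    intro s
    have := (hr0 s).ne'
    rw [hv]
    field_simp
  have hdr : ∀ s, HasDerivAt r (v s) s := by
    intro s
    have h := (((hdz s).pow 2).const_sub 1).sqrt (hr2pos s).ne'
    have hrs : Real.sqrt (1 - z s ^ 2) = r s := by rw [hr]
    have hv' : v s = -(z s * w s) / r s := by rw [hv]
    have h' : HasDerivAt r (-(((2 : ℕ) : ℝ) * z s ^ (2 - 1) * w s) / (2 * Real.sqrt (1 - z s ^ 2))) s := by
      rw [hr]
      exact h
    convert h' using 1
    rw [hrs, hv']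
    have := (hr0 s).ne'
    field_simp
    norm_num
    ring
  obtain ⟨p, hp⟩ : ∃ p : ℝ → ℝ, p = fun s => (1 - 2 * z s ^ 2 - w s ^ 2) / z s := ⟨_, rfl⟩
  have hdw : ∀ s, HasDerivAt w (p s) s := by
    intro s
    have hz := (hz0 s).ne'
    have h := ((hcos s).const_mul c).div ((hdz s).const_mul 2) (by positivity)
    rw [hw]
    refine HasDerivAt.congr_deriv h ?_
    refine Eq.symm ?_
    have h1 := hzw s
    have h2 := hz2 s
    have h3 : c * cos (2 * s) = 2 * (z s * w s) := by linarith
    have h4 : c * (-2 * sin (2 * s)) = 2 * (1 - 2 * z s ^ 2) := by linarith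
    rw [h3, h4, hp]
    field_simp
  obtain ⟨q, hq⟩ : ∃ q : ℝ → ℝ, q = fun s => (-(1 - 2 * z s ^ 2) - v s ^ 2) / r s := ⟨_, rfl⟩
  have hdv : ∀ s, HasDerivAt v (q s) s := by
    intro s
    have hz := (hz0 s).ne'
    have hr' := (hr0 s).ne'
    have h := ((hdz s).mul (hdw s)).neg.div (hdr s) hr'
    rw [hv]
    refine HasDerivAt.congr_deriv h ?_
    refine Eq.symm ?_
    have h3 := hrv s
    have h4 : z s * p s = 1 - 2 * z s ^ 2 - w s ^ 2 := by
      rw [hp]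
      field_simp
    simp only [Pi.mul_apply, Pi.neg_apply]
    rw [← h3, hq, h4]
    field_simp
    ring
  obtain ⟨L, hL⟩ : ∃ L : ℝ → ℝ, L = fun s => a / (z s * r s ^ 2) := ⟨_, rfl⟩
  have hdl : ∀ s, HasDerivAt lam (L s) s := by
    intro s
    have h := (hlamdiff s).hasDerivAt
    rw [hlam' s, ← hr2 s] at h
    rw [hL]
    exact h
  obtain ⟨M, hM⟩ : ∃ M : ℝ → ℝ, M = fun s => -L s * (w s / z s + 2 * v s / r s) := ⟨_, rfl⟩
  have hdL : ∀ s, HasDerivAt L (M s) s := by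
    intro s
    have hz := (hz0 s).ne'
    have hr' := (hr0 s).ne'
    have h := (hasDerivAt_const s a).div ((hdz s).mul ((hdr s).pow 2)) (by
      simp only [Pi.mul_apply, Pi.pow_apply]
      positivity)
    rw [hL]
    refine HasDerivAt.congr_deriv h ?_
    refine Eq.symm ?_
    simp only [Pi.mul_apply, Pi.pow_apply]
    rw [hM, hL]
    field_simp
    norm_num
    ring
  have hdx : ∀ s, HasDerivAt x (v s * cos (lam s) - r s * L s * sin (lam s)) s := by
    intro s
    rw [hx]
    refine HasDerivAt.congr_deriv ((hdr s).mul (hdl s).cos) ?_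
    ring
  have hdy : ∀ s, HasDerivAt y (v s * sin (lam s) + r s * L s * cos (lam s)) s := by
    intro s
    rw [hy]
    refine HasDerivAt.congr_deriv ((hdr s).mul (hdl s).sin) ?_
    ring
  have ex : deriv x = fun s => v s * cos (lam s) - r s * L s * sin (lam s) :=
    funext fun s => (hdx s).deriv
  have ey : deriv y = fun s => v s * sin (lam s) + r s * L s * cos (lam s) :=
    funext fun s => (hdy s).deriv
  have ez : deriv z = w := funext fun s => (hdz s).deriv
  have exx : ∀ s, deriv (deriv x) s = q s * cos (lam s) - 2 * v s * L s * sin (lam s)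
      - r s * M s * sin (lam s) - r s * L s ^ 2 * cos (lam s) := by
    intro s
    rw [ex]
    refine HasDerivAt.deriv ?_
    refine HasDerivAt.congr_deriv (((hdv s).mul (hdl s).cos).sub (((hdr s).mul (hdL s)).mul (hdl s).sin)) ?_
    try simp only [Pi.mul_apply]
    ring
  have eyy : ∀ s, deriv (deriv y) s = q s * sin (lam s) + 2 * v s * L s * cos (lam s)
      + r s * M s * cos (lam s) - r s * L s ^ 2 * sin (lam s) := by
    intro s
    rw [ey]
    refine HasDerivAt.deriv ?_
    refine HasDerivAt.congr_deriv (((hdv s).mul (hdl s).sin).add (((hdr s).mul (hdL s)).mul (hdl s).cos)) ?_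
    try simp only [Pi.mul_apply]
    ring
  have ezz : ∀ s, deriv (deriv z) s = p s := by
    intro s
    rw [ez]
    exact (hdw s).deriv
  have hLa : ∀ s, z s * r s ^ 2 * L s = a := by
    intro s
    have hz := (hz0 s).ne'
    have hr' := (hr0 s).ne'
    rw [hL]
    field_simp
  have hspeed : ∀ s, w s ^ 2 + v s ^ 2 + r s ^ 2 * L s ^ 2 = 1 := by
    intro s
    have hz := (hz0 s).ne'
    have hr' := (hr0 s).ne'
    have hne : z s ^ 2 * r s ^ 2 ≠ 0 := by positivity
    apply mul_left_cancel₀ hne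
    have h1 : z s ^ 2 * r s ^ 2 * (w s ^ 2 + v s ^ 2 + r s ^ 2 * L s ^ 2)
        = (z s * w s) ^ 2 * r s ^ 2 + z s ^ 2 * (r s * v s) ^ 2 + (z s * r s ^ 2 * L s) ^ 2 := by
      ring
    have h2 : (z s * w s) ^ 2 * r s ^ 2 + z s ^ 2 * (-(z s * w s)) ^ 2 + a ^ 2
        = (z s * w s) ^ 2 * (r s ^ 2 + z s ^ 2) + a ^ 2 := by ring
    rw [h1, hrv s, hLa s, h2, hr2 s, hzw s, hz2 s]
    have hsc := Real.sin_sq_add_cos_sq (2 * s)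
    linear_combination (c ^ 2 / 4) * hsc + (1 / 4) * hc2
  have hkap : ∀ s, sphCurv x y z s = a / z s ^ 2 := by
    intro s
    have hz := (hz0 s).ne'
    have hr' := (hr0 s).ne'
    have hsc := Real.sin_sq_add_cos_sq (lam s)
    have hzp : z s * p s = 1 - 2 * z s ^ 2 - w s ^ 2 := by
      rw [hp]
      field_simp
    have hrq : r s * q s = -(1 - 2 * z s ^ 2) - v s ^ 2 := by
      rw [hq]
      field_simp
    have hMz : z s * (2 * v s * L s + r s * M s) = -(L s * r s * w s) := by
      rw [hM]
      field_simp
      ring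
    have hE : sphCurv x y z s = r s * (r s * L s * p s - w s * (2 * v s * L s + r s * M s))
        + z s * (v s * (2 * v s * L s + r s * M s) - r s * L s * (q s - r s * L s ^ 2)) := by
      unfold sphCurv
      rw [Matrix.det_fin_three]
      simp only [exx, eyy, ezz]
      simp only [ex, ey, ez]
      simp only [hx, hy]
      simp
      linear_combination (r s * (r s * L s * p s - w s * (2 * v s * L s + r s * M s))
        + z s * (v s * (2 * v s * L s + r s * M s) - r s * L s * (q s - r s * L s ^ 2))) * hsc
    have h1 := hspeed s
    have h2 := hLa s
    have h3 := hr2 s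
    have h4 := hrv s
    rw [hE, eq_div_iff (by positivity)]
    generalize 2 * v s * L s + r s * M s = N at *
    linear_combination (z s * r s ^ 2 * L s) * hzp - (z s ^ 3 * L s) * hrq
      + (- z s * r s * w s + z s ^ 2 * v s) * hMz - (L s * w s * z s ^ 2) * h4
      + z s ^ 3 * L s * h1 + h2 + z s * L s * (- 2 * z s ^ 2) * h3
  refine ⟨fun s => ⟨hz0 s, hz1 s⟩, ?_, ?_, ?_, ?_, fun s => ⟨hkap s, ?_⟩⟩
  · intro s
    have hsc := Real.sin_sq_add_cos_sq (lam s)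
    have h3 := hr2 s
    simp only [hx, hy]
    linear_combination r s ^ 2 * hsc + h3
  · intro s
    have hsc := Real.sin_sq_add_cos_sq (lam s)
    simp only [ex, ey, ez]
    linear_combination (v s ^ 2 + r s ^ 2 * L s ^ 2) * hsc + hspeed s
  · intro s
    rw [(hdl s).deriv, ← hr2 s, hLa s]
  · intro s
    have hz := (hz0 s).ne'
    have hsc := Real.sin_sq_add_cos_sq (lam s)
    unfold sphMom
    rw [eq_div_iff hz]
    simp only [ex, ey]
    simp only [hx, hy]
    linear_combination (- z s * r s ^ 2 * L s) * hsc - hLa s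
  · rw [hkap s, hz2 s]
    have := (hpm s).1.ne'
    field_simp
end

section
/- Let φ, λ : I → ℝ be differentiable on an open interval I with φ(s) ∈ (−π/2, π/2) and φ'(s) > 0 for all s, and suppose ξ(s) = (cos φ(s)·cos λ(s), cos φ(s)·sin λ(s), sin φ(s)) satisfies ‖ξ'(s)‖ = 1 and has spherical angular momentum 𝒦(s) = −cos²φ(s)/√(1 + cos²φ(s)) for all s ∈ I. Then φ'(s) = λ'(s) = 1/√(1 + cos²φ(s)) for all s ∈ I; in particular λ − φ is constant on I, so up to a rotation around the z-axis ξ satisfies φ = λ, i.e. ξ is the Viviani curve. (The Viviani curve φ = λ is the only spherical curve, up to rotations around the z-axis, with spherical angular momentum 𝒦(φ) = −cos²φ/√(1 + cos²φ).) -/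
open Real Set

/-- Uniqueness of the Viviani curve: a unit-speed spherical curve in geographical
coordinates `(φ, λ)` with increasing latitude and angular momentum
`𝒦 = −cos²φ/√(1 + cos²φ)` satisfies `φ' = λ' = 1/√(1 + cos²φ)`; in particular `λ − φ` is
constant, so up to a rotation around the `z`-axis the curve is the Viviani curve `φ = λ`. -/
theorem viviani_uniqueness (t₀ t₁ : ℝ) (φ lam : ℝ → ℝ)
    (hφ : ∀ s ∈ Ioo t₀ t₁, DifferentiableAt ℝ φ s)
    (hlam : ∀ s ∈ Ioo t₀ t₁, DifferentiableAt ℝ lam s)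
    (hrange : ∀ s ∈ Ioo t₀ t₁, φ s ∈ Ioo (-(π / 2)) (π / 2))
    (hφ' : ∀ s ∈ Ioo t₀ t₁, deriv φ s > 0)
    (hunit : ∀ s ∈ Ioo t₀ t₁,
      deriv (fun t => cos (φ t) * cos (lam t)) s ^ 2 +
      deriv (fun t => cos (φ t) * sin (lam t)) s ^ 2 +
      deriv (fun t => sin (φ t)) s ^ 2 = 1)
    (hK : ∀ s ∈ Ioo t₀ t₁,
      sphMom (fun t => cos (φ t) * cos (lam t)) (fun t => cos (φ t) * sin (lam t)) s
        = -(cos (φ s) ^ 2) / Real.sqrt (1 + cos (φ s) ^ 2)) :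
    (∀ s ∈ Ioo t₀ t₁,
      deriv φ s = 1 / Real.sqrt (1 + cos (φ s) ^ 2) ∧
      deriv lam s = 1 / Real.sqrt (1 + cos (φ s) ^ 2)) ∧
    ∃ θ : ℝ, ∀ s ∈ Ioo t₀ t₁, lam s - φ s = θ := by
  have key : ∀ s ∈ Ioo t₀ t₁,
      deriv φ s = 1 / Real.sqrt (1 + cos (φ s) ^ 2) ∧
      deriv lam s = 1 / Real.sqrt (1 + cos (φ s) ^ 2) := by
    intro s hs
    have h1 := (hφ s hs).hasDerivAt
    have h2 := (hlam s hs).hasDerivAt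
    have hx := (h1.cos.fun_mul h2.cos).deriv
    have hy := (h1.cos.fun_mul h2.sin).deriv
    have hz := h1.sin.deriv
    have hu := hunit s hs
    have hk := hK s hs
    have hp := hφ' s hs
    have hc : 0 < cos (φ s) := cos_pos_of_mem_Ioo (hrange s hs)
    simp only [sphMom] at hk
    rw [hx, hy] at hk
    rw [hx, hy, hz] at hu
    have hw2 : Real.sqrt (1 + cos (φ s) ^ 2) ^ 2 = 1 + cos (φ s) ^ 2 :=
      Real.sq_sqrt (by positivity)
    have hw : 0 < Real.sqrt (1 + cos (φ s) ^ 2) := Real.sqrt_pos.mpr (by positivity)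
    generalize Real.sqrt (1 + cos (φ s) ^ 2) = w at *
    have e1 := sin_sq_add_cos_sq (φ s)
    have e2 := sin_sq_add_cos_sq (lam s)
    generalize deriv φ s = p at *
    generalize deriv lam s = l at *
    generalize cos (φ s) = c at *
    generalize sin (φ s) = d at *
    generalize cos (lam s) = a at *
    generalize sin (lam s) = b at *
    have hk2 : -(c ^ 2 * l) = -(c ^ 2) / w := by
      rw [← hk]; linear_combination c ^ 2 * l * e2
    have hlw : l * w = 1 := by
      rw [eq_div_iff hw.ne'] at hk2
      have : c ^ 2 * (l * w) = c ^ 2 * 1 := by linarith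
      exact mul_left_cancel₀ (by positivity) this
    have hu2 : p ^ 2 + c ^ 2 * l ^ 2 = 1 := by
      linear_combination hu - (d ^ 2 * p ^ 2 + c ^ 2 * l ^ 2) * e2 - p ^ 2 * e1
    have hpw : (p * w) ^ 2 = 1 := by
      linear_combination w ^ 2 * hu2 - c ^ 2 * (l * w + 1) * hlw + hw2
    have hpw1 : p * w = 1 := by
      have : 0 < p * w := by positivity
      nlinarith
    exact ⟨(eq_div_iff hw.ne').mpr hpw1, (eq_div_iff hw.ne').mpr hlw⟩
  refine ⟨key, ?_⟩
  refine isOpen_Ioo.exists_is_const_of_deriv_eq_zero (f := fun s => lam s - φ s)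
    isPreconnected_Ioo
    (fun s hs => ((hlam s hs).sub (hφ s hs)).differentiableWithinAt) ?_
  intro s hs
  have := ((hlam s hs).hasDerivAt.fun_sub (hφ s hs).hasDerivAt).deriv
  rw [this, (key s hs).1, (key s hs).2]
  simp
end

section
/- Let n > 0, let φ, λ : I → ℝ be differentiable on an open interval I with φ(s) ∈ (−π/2, π/2) and φ'(s) > 0 for all s, and suppose ξ(s) = (cos φ(s)·cos λ(s), cos φ(s)·sin λ(s), sin φ(s)) satisfies ‖ξ'(s)‖ = 1 and has spherical angular momentum 𝒦(s) = −cos²φ(s)/√(n² + cos²φ(s)) for all s ∈ I. Then λ'(s) = 1/√(n² + cos²φ(s)) and φ'(s) = n/√(n² + cos²φ(s)) = n·λ'(s) for all s ∈ I; in particular φ − n·λ is constant on I, so up to a rotation around the z-axis ξ satisfies φ = n·λ, i.e. ξ is a spherical Archimedean spiral (clelia). (The spherical Archimedean spirals φ = nλ are the only spherical curves, up to rotations around the z-axis, with spherical angular momentum 𝒦(φ) = −cos²φ/√(n² + cos²φ).) -/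
open Real Set

/-- Uniqueness of the spherical Archimedean spirals (clelias): a unit-speed spherical curve
in geographical coordinates `(φ, λ)` with increasing latitude and angular momentum
`𝒦 = −cos²φ/√(n² + cos²φ)` satisfies `λ' = 1/√(n² + cos²φ)` and
`φ' = n/√(n² + cos²φ) = n·λ'`; in particular `φ − n·λ` is constant, so up to a rotation
around the `z`-axis the curve is the clelia `φ = n·λ`. -/
theorem clelia_uniqueness (n : ℝ) (hn : 0 < n) (t₀ t₁ : ℝ) (φ lam : ℝ → ℝ)
    (hφ : ∀ s ∈ Ioo t₀ t₁, DifferentiableAt ℝ φ s)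
    (hlam : ∀ s ∈ Ioo t₀ t₁, DifferentiableAt ℝ lam s)
    (hrange : ∀ s ∈ Ioo t₀ t₁, φ s ∈ Ioo (-(π / 2)) (π / 2))
    (hφ' : ∀ s ∈ Ioo t₀ t₁, deriv φ s > 0)
    (hunit : ∀ s ∈ Ioo t₀ t₁,
      deriv (fun t => cos (φ t) * cos (lam t)) s ^ 2 +
      deriv (fun t => cos (φ t) * sin (lam t)) s ^ 2 +
      deriv (fun t => sin (φ t)) s ^ 2 = 1)
    (hK : ∀ s ∈ Ioo t₀ t₁,
      sphMom (fun t => cos (φ t) * cos (lam t)) (fun t => cos (φ t) * sin (lam t)) s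
        = -(cos (φ s) ^ 2) / Real.sqrt (n ^ 2 + cos (φ s) ^ 2)) :
    (∀ s ∈ Ioo t₀ t₁,
      deriv lam s = 1 / Real.sqrt (n ^ 2 + cos (φ s) ^ 2) ∧
      deriv φ s = n / Real.sqrt (n ^ 2 + cos (φ s) ^ 2) ∧
      deriv φ s = n * deriv lam s) ∧
    ∃ θ : ℝ, ∀ s ∈ Ioo t₀ t₁, φ s - n * lam s = θ := by
  have key : ∀ s ∈ Ioo t₀ t₁,
      deriv lam s = 1 / Real.sqrt (n ^ 2 + cos (φ s) ^ 2) ∧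
      deriv φ s = n / Real.sqrt (n ^ 2 + cos (φ s) ^ 2) ∧
      deriv φ s = n * deriv lam s := by
    intro s hs
    have h1 := (hφ s hs).hasDerivAt
    have h2 := (hlam s hs).hasDerivAt
    have hx := (h1.cos.fun_mul h2.cos).deriv
    have hy := (h1.cos.fun_mul h2.sin).deriv
    have hz := h1.sin.deriv
    have hu := hunit s hs
    have hk := hK s hs
    have hp := hφ' s hs
    have hc : 0 < cos (φ s) := cos_pos_of_mem_Ioo (hrange s hs)
    unfold sphMom at hk
    rw [hx, hy] at hk
    beta_reduce at hk
    rw [hx, hy, hz] at hu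
    have hR : 0 < Real.sqrt (n ^ 2 + cos (φ s) ^ 2) := Real.sqrt_pos.2 (by positivity)
    have hR2 : Real.sqrt (n ^ 2 + cos (φ s) ^ 2) ^ 2 = n ^ 2 + cos (φ s) ^ 2 :=
      Real.sq_sqrt (by positivity)
    have e1 := sin_sq_add_cos_sq (φ s)
    have e2 := sin_sq_add_cos_sq (lam s)
    generalize Real.sqrt (n ^ 2 + cos (φ s) ^ 2) = R at *
    generalize deriv φ s = p at *
    generalize deriv lam s = l at *
    generalize cos (φ s) = c at *
    generalize sin (φ s) = d at *
    generalize cos (lam s) = a at *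
    generalize sin (lam s) = b at *
    have hk2 : -(c ^ 2 * l) = -(c ^ 2) / R := by
      rw [← hk]; linear_combination (c ^ 2 * l) * e2
    have hlR : l * R = 1 := by
      rw [eq_div_iff hR.ne'] at hk2
      have hc2 : c ^ 2 ≠ 0 := by positivity
      apply mul_left_cancel₀ hc2
      linear_combination -hk2
    have hu2 : p ^ 2 + c ^ 2 * l ^ 2 = 1 := by
      rw [← hu]
      linear_combination (-(d ^ 2 * p ^ 2) - c ^ 2 * l ^ 2) * e2 - p ^ 2 * e1
    have hpR : p * R = n := by
      have h : (p * R) ^ 2 = n ^ 2 := by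
        linear_combination R ^ 2 * hu2 - c ^ 2 * (l * R + 1) * hlR + hR2
      exact (pow_left_inj₀ (by positivity) hn.le two_ne_zero).1 h
    refine ⟨(eq_div_iff hR.ne').2 hlR, (eq_div_iff hR.ne').2 hpR, ?_⟩
    apply mul_right_cancel₀ hR.ne'
    linear_combination hpR - n * hlR
  refine ⟨key, ?_⟩
  have hd : ∀ s ∈ Ioo t₀ t₁, HasDerivAt (fun t => φ t - n * lam t) 0 s := by
    intro s hs
    have h := (hφ s hs).hasDerivAt.fun_sub ((hlam s hs).hasDerivAt.const_mul n)
    rwa [(key s hs).2.2, sub_self] at h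
  exact isOpen_Ioo.exists_is_const_of_deriv_eq_zero isPreconnected_Ioo
    (fun s hs => (hd s hs).differentiableAt.differentiableWithinAt)
    (fun s hs => (hd s hs).deriv)
end
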